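/- If G is a graph that is both minimally 3-connected and critically 3-connected, then the number of vertices of G having degree exactly three is at least (|V(G)| + 3)/2; equivalently, 2·|{v ∈ V(G) : deg(v) = 3}| ≥ |V(G)| + 3. -/

import Mathlib

open SimpleGraph

/-- A graph is `k`-connected if it has more than `k` vertices and the deletion of any set of
fewer than `k` vertices leaves a connected graph (equivalently, there is no vertex cut of size
less than `k`). -/
def KConnected {V : Type*} (k : ℕ) (G : SimpleGraph V) : Prop :=
  k < Nat.card V ∧ ∀ S : Set V, S.ncard < k → (G.induce Sᶜ).Connected

/-- A graph is minimally `k`-connected if it is `k`-connected but the deletion of any edge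
destroys `k`-connectedness. -/
def MinimallyKConnected {V : Type*} (k : ℕ) (G : SimpleGraph V) : Prop :=
  KConnected k G ∧ ∀ e ∈ G.edgeSet, ¬ KConnected k (G.deleteEdges {e})

/-- A graph is critically `k`-connected if it is `k`-connected but the deletion of any vertex
destroys `k`-connectedness. -/
def CriticallyKConnected {V : Type*} (k : ℕ) (G : SimpleGraph V) : Prop :=
  KConnected k G ∧ ∀ v : V, ¬ KConnected k (G.induce {v}ᶜ)

namespace ThreeConnectedCount

universe u
variable {V : Type u} {G : SimpleGraph V}

/-- `3`-connectedness, phrased by two-element separators `{s, t}` of vertex sets `L`. -/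
structure Three (G : SimpleGraph V) : Prop where
  card : 4 ≤ Nat.card V
  sep : ∀ (s t : V) (L : Set V), (∃ p ∈ L, p ≠ s ∧ p ≠ t) →
    (∀ p ∈ L, p ≠ s → p ≠ t → ∀ q, G.Adj p q → q ∈ L ∨ q = s ∨ q = t) →
    ∀ w, w ∈ L ∨ w = s ∨ w = t

/-- The vertex `v` has at most three neighbours. -/
def Cub (G : SimpleGraph V) (v : V) : Prop :=
  ∃ p q r, ∀ w, G.Adj v w → w = p ∨ w = q ∨ w = r

/-- The edge `uv` is the only edge between `L` and `R`, two sets with at least two vertices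
that together with `x` and `y` partition the vertex set. -/
structure EssAt (G : SimpleGraph V) (u v : V) (L R : Set V) (x y : V) : Prop where
  adj : G.Adj u v
  cover : ∀ w, w ∈ L ∨ w ∈ R ∨ w = x ∨ w = y
  disj : ∀ w ∈ L, w ∉ R
  xL : x ∉ L
  xR : x ∉ R
  yL : y ∉ L
  yR : y ∉ R
  uL : u ∈ L
  vR : v ∈ R
  cross : ∀ p ∈ L, ∀ q ∈ R, G.Adj p q → p = u ∧ q = v
  left : ∃ p ∈ L, p ≠ u
  right : ∃ p ∈ R, p ≠ v

/-- The edge `uv` is essential: deleting it creates a non-trivial `2`-separation. -/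
def Ess (G : SimpleGraph V) (u v : V) : Prop := ∃ L R x y, EssAt G u v L R x y

/-- A mixed `3`-separation with sides `P` and `Q`: each of its three members is a common vertex
`a i = b i` or an edge from `a i` to `b i`. -/
structure Sep (G : SimpleGraph V) (P Q : Set V) (a b : Fin 3 → V) : Prop where
  cover : ∀ w, w ∈ P ∨ w ∈ Q
  aP : ∀ i, a i ∈ P
  bQ : ∀ i, b i ∈ Q
  aQ : ∀ i, a i ∈ Q → a i = b i
  bP : ∀ i, b i ∈ P → a i = b i
  adj : ∀ i, a i ≠ b i → G.Adj (a i) (b i)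
  ends : ∀ x, x ∈ P → x ∈ Q → ∃ i, a i = x
  cross : ∀ p q, p ∉ Q → q ∉ P → G.Adj p q → ∃ i, a i = p ∧ b i = q
  ainj : ∀ i j, a i = a j → i = j
  binj : ∀ i j, b i = b j → i = j
  twoA : ∃ p p', p ≠ p' ∧ p ∉ Q ∧ p' ∉ Q
  twoB : ∃ p p', p ≠ p' ∧ p ∉ P ∧ p' ∉ P

/-- Every common vertex of the separation has two private neighbours on the side of `P`. -/
def Thick (G : SimpleGraph V) (P Q : Set V) : Prop :=
  ∀ x ∈ P, x ∈ Q → ∃ p p', p ≠ p' ∧ p ∉ Q ∧ p' ∉ Q ∧ G.Adj x p ∧ G.Adj x p'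

theorem Three.exists_adj (h : Three G) (v s t : V) : ∃ q, G.Adj v q ∧ q ≠ s ∧ q ≠ t := by
  by_contra! hc
  have key : ∀ s' t', s' ≠ v → t' ≠ v → (∀ q, G.Adj v q → q = s' ∨ q = t') → False := by
    intro s' t' hs ht hq
    have := h.sep s' t' {v} ⟨v, rfl, hs.symm, ht.symm⟩ (by
      rintro p rfl _ _ q hpq; exact Or.inr (hq q hpq))
    have h4 := h.card
    have hsub : (Set.univ : Set V) ⊆ ({v, s', t'} : Set V) := by
      intro w _; simpa using this w
    have h3 : (Set.univ : Set V).ncard ≤ 3 :=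
      (Set.ncard_le_ncard hsub (by simp)).trans (by
        refine (Set.ncard_insert_le _ _).trans ?_
        have := Set.ncard_insert_le s' {t'}
        have h1 := Set.ncard_singleton t'
        omega)
    rw [Set.ncard_univ] at h3
    omega
  have hne : ∀ q, G.Adj v q → q ≠ v := fun q hq => hq.ne'
  by_cases hs : s = v
  · by_cases ht : t = v
    · have : Nontrivial V := by
        have := h.card
        have : Finite V := Nat.finite_of_card_ne_zero (by omega)
        exact Finite.one_lt_card_iff_nontrivial.1 (by omega)
      obtain ⟨w, hw⟩ := exists_ne v
      exact key w w hw hw (fun q hq => by grind)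
    · exact key t t ht ht (fun q hq => by grind)
  · by_cases ht : t = v
    · exact key s s hs hs (fun q hq => by grind)
    · exact key s t hs ht (fun q hq => by grind)

theorem EssAt.symm {u v x y : V} {L R : Set V} (h : EssAt G u v L R x y) :
    EssAt G v u R L x y where
  adj := h.adj.symm
  cover w := by have := h.cover w; tauto
  disj w hw hw' := h.disj w hw' hw
  xL := h.xR
  xR := h.xL
  yL := h.yR
  yR := h.yL
  uL := h.vR
  vR := h.uL
  cross p hp q hq hpq := (h.cross q hq p hp hpq.symm).symm
  left := h.right
  right := h.left

theorem EssAt.swap {u v x y : V} {L R : Set V} (h : EssAt G u v L R x y) :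
    EssAt G u v L R y x :=
  ⟨h.adj, fun w => by have := h.cover w; tauto, h.disj, h.yL, h.yR, h.xL, h.xR, h.uL, h.vR,
    h.cross, h.left, h.right⟩

theorem Ess.symm {u v : V} (h : Ess G u v) : Ess G v u := by
  obtain ⟨L, R, x, y, h⟩ := h
  exact ⟨R, L, x, y, h.symm⟩

theorem EssAt.exists_adj_left {u v x y : V} {L R : Set V} (h : EssAt G u v L R x y)
    (h3 : Three G) : ∃ p ∈ L, p ≠ u ∧ G.Adj x p := by
  by_contra! hc
  obtain ⟨p, hp, hpu⟩ := h.left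
  have := h3.sep u y L ⟨p, hp, hpu, fun e => h.yL (e ▸ hp)⟩ (by
    intro p hp hpu hpy q hpq
    have := h.cover q
    have := h.cross p hp q
    have := hc p hp hpu
    grind [G.adj_comm]) v
  have := h.disj v
  have := h.vR
  have := h.adj.ne
  have := h.yR
  grind

theorem Ess.not_cub {u v z : V} (h : Ess G u v) (h3 : Three G) (hu : G.Adj z u)
    (hv : G.Adj z v) : ¬ Cub G z := by
  obtain ⟨L, R, x, y, h⟩ := h
  have key : ∀ x y, EssAt G u v L R x y → z = x → ¬ Cub G z := by
    rintro x y h rfl ⟨p, q, r, hc⟩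
    obtain ⟨s, hs, hsu, hzs⟩ := h.exists_adj_left h3
    obtain ⟨t, ht, htv, hzt⟩ := h.symm.exists_adj_left h3
    have h1 := hc _ hu
    have h2 := hc _ hv
    have h4 := hc _ hzs
    have h5 := hc _ hzt
    have := h.uL
    have := h.vR
    have := h.disj u
    have := h.disj s
    grind
  rcases h.cover z with hz | hz | hz | hz
  · exact absurd (h.cross z hz v h.vR hv).1 hu.ne
  · exact absurd (h.cross u h.uL z hz hu.symm).2 hv.ne
  · exact key x y h hz
  · exact key y x h.swap hz

theorem EssAt.ne {u v x y : V} {L R : Set V} (h : EssAt G u v L R x y)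
    (h3 : Three G) : x ≠ y := by
  rintro rfl
  obtain ⟨p, hp, hpu⟩ := h.left
  have := h3.sep u x L ⟨p, hp, hpu, fun e => h.xL (e ▸ hp)⟩ (by
    intro p hp hpu hpy q hpq
    have := h.cover q
    have := h.cross p hp q
    grind) v
  have := h.disj v
  have := h.vR
  have := h.adj.ne
  have := h.xR
  grind

theorem EssAt.sep {u v x y : V} {L R : Set V} (h : EssAt G u v L R x y) (h3 : Three G) :
    Sep G Rᶜ Lᶜ ![u, x, y] ![v, x, y] := by
  have hxy := h.ne h3
  obtain ⟨adj, cover, disj, xL, xR, yL, yR, uL, vR, cross, left, right⟩ := h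
  have := disj u uL
  have := disj v
  refine ⟨?_, ?_, ?_, ?_, ?_, ?_, ?_, ?_, ?_, ?_, ?_, ?_⟩
  · intro w; have := disj w; simp; tauto
  · intro i; fin_cases i <;> simp <;> grind
  · intro i; fin_cases i <;> simp <;> grind
  · intro i; fin_cases i <;> simp <;> grind
  · intro i; fin_cases i <;> simp <;> grind
  · intro i; fin_cases i <;> simp <;> grind
  · intro w h1 h2
    rcases cover w with h | h | rfl | rfl
    · exact absurd h h2
    · exact absurd h h1
    · exact ⟨1, rfl⟩
    · exact ⟨2, rfl⟩
  · intro p q hp hq hpq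
    obtain ⟨rfl, rfl⟩ := cross p (by simpa using hp) q (by simpa using hq) hpq
    exact ⟨0, rfl, rfl⟩
  · intro i j; fin_cases i <;> fin_cases j <;> simp <;> grind
  · intro i j; fin_cases i <;> fin_cases j <;> simp <;> grind
  · obtain ⟨p, hp, hpu⟩ := left
    exact ⟨p, u, hpu, by simpa using hp, by simpa using uL⟩
  · obtain ⟨p, hp, hpu⟩ := right
    exact ⟨p, v, hpu, by simpa using hp, by simpa using vR⟩

variable {P Q : Set V} {a b : Fin 3 → V}

theorem Sep.symm (h : Sep G P Q a b) : Sep G Q P b a where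
  cover w := (h.cover w).symm
  aP := h.bQ
  bQ := h.aP
  aQ i hi := (h.bP i hi).symm
  bP i hi := (h.aQ i hi).symm
  adj i hi := (h.adj i hi.symm).symm
  ends x hx hx' := by
    obtain ⟨i, rfl⟩ := h.ends x hx' hx
    exact ⟨i, (h.aQ i hx).symm⟩
  cross p q hp hq hpq := by
    obtain ⟨i, h1, h2⟩ := h.cross q p hq hp hpq.symm
    exact ⟨i, h2, h1⟩
  ainj := h.binj
  binj := h.ainj
  twoA := h.twoB
  twoB := h.twoA

theorem fin_three_others (i : Fin 3) :
    ∃ j k, i ≠ j ∧ i ≠ k ∧ j ≠ k ∧ ∀ l, l = i ∨ l = j ∨ l = k := by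
  revert i; decide

theorem Sep.exists_private_adj (h : Sep G P Q a b) (h3 : Three G) {i j k : Fin 3} (hij : i ≠ j)
    (hik : i ≠ k) (hjk : j ≠ k) (hl : ∀ l, l = i ∨ l = j ∨ l = k) (hi : a i ∈ Q) :
    ∃ c, c ∉ Q ∧ G.Adj (a i) c ∧ c ≠ a j := by
  by_contra! hc
  have hA : ∀ p, p ∉ Q → p = a j ∨ p = a k := by
    intro p hp
    by_contra! hne
    have := h3.sep (a j) (a k) {p | p ∉ Q} ⟨p, hp, hne⟩ (by
      intro p hp h1 h2 q hpq
      simp only [Set.mem_ofPred_eq] at *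
      by_cases hq : q ∈ Q
      · by_cases hqP : q ∈ P
        · obtain ⟨l, rfl⟩ := h.ends q hqP hq
          rcases hl l with rfl | rfl | rfl
          · exact absurd (hc p hp hpq.symm) h1
          · exact Or.inr (Or.inl rfl)
          · exact Or.inr (Or.inr rfl)
        · obtain ⟨l, rfl, rfl⟩ := h.cross p q hp hqP hpq
          rcases hl l with rfl | rfl | rfl
          · exact absurd hi hp
          · exact absurd rfl h1
          · exact absurd rfl h2
      · exact Or.inl hq) (a i)
    rcases this with h1 | h1 | h1
    · exact h1 hi
    · exact hij (h.ainj _ _ h1)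
    · exact hik (h.ainj _ _ h1)
  obtain ⟨p, p', hpp, hp, hp'⟩ := h.twoA
  have hk : a k ∉ Q := by
    rcases hA p hp with rfl | rfl
    · rcases hA p' hp' with rfl | rfl
      · exact absurd rfl hpp
      · exact hp'
    · exact hp
  obtain ⟨q, hq, h1, h2⟩ := h3.exists_adj (a k) (a j) (b k)
  by_cases hqQ : q ∈ Q
  · by_cases hqP : q ∈ P
    · obtain ⟨l, rfl⟩ := h.ends q hqP hqQ
      rcases hl l with rfl | rfl | rfl
      · exact hjk (h.ainj _ _ (hc (a k) hk hq.symm)).symm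
      · exact h1 rfl
      · exact hk hqQ
    · obtain ⟨l, h5, rfl⟩ := h.cross (a k) q hk hqP hq
      obtain rfl := h.ainj _ _ h5
      exact h2 rfl
  · rcases hA q hqQ with rfl | rfl
    · exact h1 rfl
    · exact hq.ne rfl

theorem Sep.exists_thick [Finite V] (h : Sep G P Q a b) (h3 : Three G) :
    ∃ P Q a b, Sep G P Q a b ∧ Thick G P Q ∧ Thick G Q P := by
  have step : ∀ {P Q : Set V} {a b : Fin 3 → V}, Sep G P Q a b → ¬ Thick G P Q →
      ∃ P' a', Sep G P' Q a' b ∧ (P' ∩ Q).ncard < (P ∩ Q).ncard := by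
    intro P Q a b h hT
    unfold Thick at hT
    push Not at hT
    obtain ⟨x, hxP, hxQ, hx⟩ := hT
    obtain ⟨i, rfl⟩ := h.ends x hxP hxQ
    obtain ⟨j, k, hij, hik, hjk, hl⟩ := fin_three_others i
    obtain ⟨c, hcQ, hc, hcj⟩ := h.exists_private_adj h3 hij hik hjk hl hxQ
    obtain ⟨c', hcQ', hc', hck⟩ := h.exists_private_adj h3 hik hij hjk.symm
      (fun l => by have := hl l; tauto) hxQ
    obtain rfl : c = c' := by
      by_contra hne
      exact hx c c' hne hcQ hcQ' hc hc'
    refine ⟨P \ {a i}, Function.update a i c, ?_, ?_⟩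
    · obtain ⟨cover, aP, bQ, aQ, bP, adj, ends, cross, ainj, binj, twoA, twoB⟩ := h
      have hci : c ≠ a i := hc.ne'
      have hbi := aQ i hxQ
      have hi' : Function.update a i c i = c := by simp
      have hj' : Function.update a i c j = a j := by simp [hij.symm]
      have hk' : Function.update a i c k = a k := by simp [hik.symm]
      have hcP : c ∈ P := (cover c).resolve_right hcQ
      have hij' : a i ≠ a j := fun e => hij (ainj _ _ e)
      have hik' : a i ≠ a k := fun e => hik (ainj _ _ e)
      have hjk' : a j ≠ a k := fun e => hjk (ainj _ _ e)
      have hbij' : b i ≠ b j := fun e => hij (binj _ _ e)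
      have hbik' : b i ≠ b k := fun e => hik (binj _ _ e)
      refine ⟨?_, ?_, bQ, ?_, ?_, ?_, ?_, ?_, ?_, binj, twoA, ?_⟩
      · intro w; have := cover w; by_cases hw : w = a i <;> grind
      · intro l; rcases hl l with rfl | rfl | rfl <;> grind
      · intro l; rcases hl l with rfl | rfl | rfl <;> grind
      · intro l; rcases hl l with rfl | rfl | rfl <;> grind
      · intro l; rcases hl l with rfl | rfl | rfl <;> grind [G.adj_comm]
      · intro w hw hwQ
        obtain ⟨l, rfl⟩ := ends w hw.1 hwQ
        rcases hl l with rfl | rfl | rfl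
        · exact absurd rfl hw.2
        · exact ⟨_, hj'⟩
        · exact ⟨_, hk'⟩
      · intro p q hp hq hpq
        by_cases hqi : q = a i
        · subst hqi
          have : p = c := by
            by_contra hne
            exact hx p c hne hp hcQ hpq.symm hc
          exact ⟨i, by grind⟩
        · obtain ⟨l, h1, h2⟩ := cross p q hp (by grind) hpq
          refine ⟨l, ?_⟩
          rcases hl l with rfl | rfl | rfl <;> grind
      · intro l m
        rcases hl l with rfl | rfl | rfl <;> rcases hl m with rfl | rfl | rfl <;> grind
      · obtain ⟨p, p', h1, h2, h4⟩ := twoB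
        exact ⟨p, p', h1, by grind, by grind⟩
    · apply Set.ncard_lt_ncard _ (Set.toFinite _)
      refine ⟨fun w hw => ⟨hw.1.1, hw.2⟩, fun hs => ?_⟩
      exact (hs ⟨hxP, hxQ⟩).1.2 rfl
  induction hn : (P ∩ Q).ncard using Nat.strong_induction_on generalizing P Q a b with
  | _ n ih =>
    by_cases hP : Thick G P Q
    · by_cases hQ : Thick G Q P
      · exact ⟨P, Q, a, b, h, hP, hQ⟩
      · obtain ⟨Q', b', h', hlt⟩ := step h.symm hQ
        refine ih _ ?_ h'.symm rfl
        rw [Set.inter_comm, ← hn, Set.inter_comm P]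
        exact hlt
    · obtain ⟨P', a', h', hlt⟩ := step h hP
      exact ih _ (hn ▸ hlt) h' rfl

theorem Three.of_parts (h4 : 4 ≤ Nat.card V)
    (H : ∀ (s t : V) (L R : Set V), L.Nonempty → R.Nonempty →
      (∀ w, w ∈ L ∨ w ∈ R ∨ w = s ∨ w = t) → (∀ w ∈ L, w ∉ R) →
      (∀ w ∈ L, w ≠ s ∧ w ≠ t) → (∀ w ∈ R, w ≠ s ∧ w ≠ t) →
      (∀ p ∈ L, ∀ q ∈ R, ¬ G.Adj p q) → False) : Three G where
  card := h4
  sep s t L hL hc w := by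
    by_contra! hw
    refine H s t {p | p ∈ L ∧ p ≠ s ∧ p ≠ t} {p | p ∉ L ∧ p ≠ s ∧ p ≠ t} hL ⟨w, hw⟩ ?_ ?_ ?_ ?_ ?_
    · intro w; simp only [Set.mem_ofPred_eq]; tauto
    · exact fun w hw hw' => hw'.1 hw.1
    · exact fun w hw => hw.2
    · exact fun w hw => hw.2
    · intro p hp q hq hpq
      have := hc p hp.1 hp.2.1 hp.2.2 q hpq
      have := hq.1
      have := hq.2
      tauto

/-- The part of `G` on the side of `P`, with the other side replaced by a single vertex `none`
and with the edges inside the common part removed. -/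
def side (G : SimpleGraph V) (P Q : Set V) (a : Fin 3 → V) : SimpleGraph (Option P) where
  Adj
    | some p, some q => G.Adj p q ∧ ¬ (p.1 ∈ Q ∧ q.1 ∈ Q)
    | some p, none => ∃ i, a i = p
    | none, some p => ∃ i, a i = p
    | none, none => False
  symm := ⟨by
    rintro (_ | p) (_ | q) h
    · exact h
    · exact h
    · exact h
    · exact ⟨h.1.symm, fun hh => h.2 hh.symm⟩⟩
  loopless := ⟨by
    rintro (_ | p) h
    · exact h
    · exact h.1.ne rfl⟩

theorem side_some_some {p q : P} : (side G P Q a).Adj (some p) (some q) ↔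
    G.Adj p q ∧ ¬ (p.1 ∈ Q ∧ q.1 ∈ Q) := Iff.rfl

theorem side_some_none {p : P} : (side G P Q a).Adj (some p) none ↔ ∃ i, a i = p := Iff.rfl

theorem fin_three_pigeonhole (f g : Fin 3 → Prop) (h : ∀ i, f i → ¬ g i) :
    (∃ j, ∀ i, f i → i = j) ∨ (∃ j, ∀ i, g i → i = j) := by
  by_contra! hc
  obtain ⟨h1, h2⟩ := hc
  obtain ⟨i, hi, -⟩ := h1 0
  obtain ⟨j, hj, hij⟩ := h1 i
  obtain ⟨k, hk, -⟩ := h2 0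
  obtain ⟨l, hl, hkl⟩ := h2 k
  have h3 : i ≠ k := fun e => h i hi (e ▸ hk)
  have h4 : i ≠ l := fun e => h i hi (e ▸ hl)
  have h5 : j ≠ k := fun e => h j hj (e ▸ hk)
  have h6 : j ≠ l := fun e => h j hj (e ▸ hl)
  omega

theorem Sep.card_side_lt [Finite V] (h : Sep G P Q a b) : Nat.card (Option P) < Nat.card V := by
  obtain ⟨p, p', hne, hp, hp'⟩ := h.twoB
  have h1 : 1 < (Pᶜ).ncard := (Set.one_lt_ncard_iff (Set.toFinite _)).2 ⟨p, p', hp, hp', hne⟩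
  have h2 := Set.ncard_add_ncard_compl P
  have h3 : Nat.card (Option P) = P.ncard + 1 := Finite.card_option
  omega

theorem Sep.four_le_card_side [Finite V] (h : Sep G P Q a b) : 4 ≤ Nat.card (Option P) := by
  have h1 : Nat.card (Option (Fin 3)) ≤ Nat.card (Option P) := by
    refine Nat.card_le_card_of_injective (Option.map fun i => (⟨a i, h.aP i⟩ : P)) ?_
    exact Option.map_injective fun i j hij => h.ainj i j (congrArg Subtype.val hij)
  simpa using h1

theorem Sep.side_three [Finite V] (h : Sep G P Q a b) (h3 : Three G) (hT : Thick G P Q) :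
    Three (side G P Q a) := by
  refine Three.of_parts h.four_le_card_side ?_
  have caseA : ∀ (s t : P) (L R : Set (Option P)), L.Nonempty → none ∈ R →
      (∀ w, w ∈ L ∨ w ∈ R ∨ w = s ∨ w = t) → (∀ w ∈ L, w ∉ R) →
      (∀ w ∈ L, w ≠ s ∧ w ≠ t) →
      (∀ p ∈ L, ∀ q ∈ R, ¬ (side G P Q a).Adj p q) → False := by
    intro s t L R hL hR hcov hdis hLst hno
    have hend : ∀ p : P, some p ∈ L → ∀ i, a i ≠ p := fun p hp i hi =>
      hno _ hp _ hR (side_some_none.2 ⟨i, hi⟩)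
    obtain ⟨p, hp⟩ := hL
    obtain - | p := p
    · exact hdis _ hp hR
    have := h3.sep s t {p | ∃ hp : p ∈ P, some ⟨p, hp⟩ ∈ L}
      ⟨p, ⟨p.2, hp⟩, fun e => (hLst _ hp).1 (by rw [Subtype.ext e]),
        fun e => (hLst _ hp).2 (by rw [Subtype.ext e])⟩ (by
        rintro p ⟨hpP, hp⟩ h1 h2 q hpq
        have hpQ : p ∉ Q := fun hpQ => by
          obtain ⟨i, hi⟩ := h.ends p hpP hpQ
          exact hend _ hp i hi
        by_cases hqP : q ∈ P
        · have hadj : (side G P Q a).Adj (some ⟨p, hpP⟩) (some ⟨q, hqP⟩) :=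
            ⟨hpq, fun hh => hpQ hh.1⟩
          rcases hcov (some ⟨q, hqP⟩) with h5 | h5 | h5 | h5
          · exact Or.inl ⟨hqP, h5⟩
          · exact absurd hadj (hno _ hp _ h5)
          · exact Or.inr (Or.inl (congrArg Subtype.val (Option.some.inj h5)))
          · exact Or.inr (Or.inr (congrArg Subtype.val (Option.some.inj h5)))
        · obtain ⟨i, hi, -⟩ := h.cross p q hpQ hqP hpq
          exact absurd hi (hend _ hp i))
    obtain ⟨c, -, -, hc, -⟩ := h.twoB
    rcases this c with ⟨h5, -⟩ | rfl | rfl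
    · exact hc h5
    · exact hc s.2
    · exact hc t.2
  have caseB' : ∀ (s : Option P) (L R : Set (Option P)) (j : Fin 3), L.Nonempty →
      (∀ w, w ∈ L ∨ w ∈ R ∨ w = s ∨ w = none) →
      (∀ w ∈ L, w ≠ s ∧ w ≠ none) →
      (∀ p ∈ L, ∀ q ∈ R, ¬ (side G P Q a).Adj p q) →
      (∀ i, some ⟨a i, h.aP i⟩ ∈ L → i = j) → False := by
    intro s L R j hL hcov hLst hno hj
    have hfs : ∀ p : P, s = some p → s.elim (b j) Subtype.val = p := by rintro p rfl; rfl
    have hfL : ∀ p : P, some p ∈ L → p.1 ≠ b j → p.1 ≠ s.elim (b j) Subtype.val := by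
      intro p hp h1 h2
      obtain - | s := s
      · exact h1 h2
      · exact (hLst _ hp).1 (by rw [Subtype.ext h2])
    have hne : ∃ p : P, some p ∈ L ∧ p.1 ≠ b j := by
      obtain ⟨p, hp⟩ := hL
      obtain - | p := p
      · exact absurd rfl (hLst _ hp).2
      by_cases hpb : p.1 = b j
      · obtain ⟨c, c', hcc, hc, hc', hpc, hpc'⟩ := hT p p.2 (hpb ▸ h.bQ j)
        have key : ∀ c, c ∉ Q → G.Adj p c → c ≠ s.elim (b j) Subtype.val →
            ∃ p : P, some p ∈ L ∧ p.1 ≠ b j := by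
          intro c hc hpc hcs
          have hcP := (h.cover c).resolve_right hc
          refine ⟨⟨c, hcP⟩, ?_, fun e => hc ((show c = b j from e) ▸ h.bQ j)⟩
          rcases hcov (some ⟨c, hcP⟩) with h5 | h5 | h5 | h5
          · exact h5
          · exact absurd (side_some_some.2 ⟨hpc, fun hh => hc hh.2⟩) (hno _ hp _ h5)
          · exact absurd (hfs _ h5.symm).symm hcs
          · cases h5
        by_cases hcs : c = s.elim (b j) Subtype.val
        · exact key c' hc' hpc' (hcs ▸ hcc.symm)
        · exact key c hc hpc hcs
      · exact ⟨p, hp, hpb⟩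
    obtain ⟨p, hp, hpb⟩ := hne
    have := h3.sep (s.elim (b j) Subtype.val) (b j)
      {p | ∃ hp : p ∈ P, some ⟨p, hp⟩ ∈ L} ⟨p, ⟨p.2, hp⟩, hfL _ hp hpb, hpb⟩ (by
        rintro p ⟨hpP, hp⟩ h1 h2 q hpq
        have hpQ : p ∉ Q := fun hpQ => by
          obtain ⟨i, rfl⟩ := h.ends p hpP hpQ
          obtain rfl := hj i hp
          exact h2 (h.aQ _ hpQ)
        by_cases hqP : q ∈ P
        · rcases hcov (some ⟨q, hqP⟩) with h5 | h5 | h5 | h5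
          · exact Or.inl ⟨hqP, h5⟩
          · exact absurd (side_some_some.2 ⟨hpq, fun hh => hpQ hh.1⟩) (hno _ hp _ h5)
          · exact Or.inr (Or.inl (hfs _ h5.symm).symm)
          · cases h5
        · obtain ⟨i, rfl, rfl⟩ := h.cross p q hpQ hqP hpq
          obtain rfl := hj i hp
          exact Or.inr (Or.inr rfl))
    have key : ∀ c, c ∉ P → c = b j := by
      intro c hc
      rcases this c with ⟨h5, -⟩ | h5 | h5
      · exact absurd h5 hc
      · obtain - | s := s
        · exact h5
        · exact absurd (h5 ▸ s.2) hc
      · exact h5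
    obtain ⟨c, c', hcc, hc, hc'⟩ := h.twoB
    exact hcc ((key c hc).trans (key c' hc').symm)
  have caseB : ∀ (s : Option P) (L R : Set (Option P)), L.Nonempty → R.Nonempty →
      (∀ w, w ∈ L ∨ w ∈ R ∨ w = s ∨ w = none) → (∀ w ∈ L, w ∉ R) →
      (∀ w ∈ L, w ≠ s ∧ w ≠ none) → (∀ w ∈ R, w ≠ s ∧ w ≠ none) →
      (∀ p ∈ L, ∀ q ∈ R, ¬ (side G P Q a).Adj p q) → False := by
    intro s L R hL hR hcov hdis hLst hRst hno
    rcases fin_three_pigeonhole (fun i => some ⟨a i, h.aP i⟩ ∈ L) (fun i => some ⟨a i, h.aP i⟩ ∈ R)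
      (fun i hi => hdis _ hi) with ⟨j, hj⟩ | ⟨j, hj⟩
    · exact caseB' s L R j hL hcov hLst hno hj
    · exact caseB' s R L j hR (fun w => by have := hcov w; tauto) hRst
        (fun p hp q hq hpq => hno q hq p hp hpq.symm) hj
  intro s t L R hL hR hcov hdis hLst hRst hno
  obtain - | t := t
  · exact caseB s L R hL hR hcov hdis hLst hRst hno
  obtain - | s := s
  · exact caseB (some t) L R hL hR (fun w => by have := hcov w; tauto) hdis
      (fun w hw => (hLst w hw).symm) (fun w hw => (hRst w hw).symm) hno
  rcases hcov none with h5 | h5 | h5 | h5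
  · exact caseA s t R L hR h5 (fun w => by have := hcov w; tauto) (fun w hw hw' => hdis w hw' hw)
      hRst (fun p hp q hq hpq => hno q hq p hp hpq.symm)
  · exact caseA s t L R hL h5 hcov hdis hLst hno
  · cases h5
  · cases h5

theorem Sep.cub_side_iff (h : Sep G P Q a b) {v : V} (hv : v ∈ P) (hvQ : v ∉ Q) :
    Cub (side G P Q a) (some ⟨v, hv⟩) ↔ Cub G v := by
  classical
  constructor
  · rintro ⟨p, q, r, hc⟩
    obtain ⟨d, hd⟩ : ∃ d, ∀ i, a i = v → b i = d := by
      by_cases hi : ∃ i, a i = v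
      · obtain ⟨i, hi⟩ := hi
        exact ⟨b i, fun j hj => by rw [h.ainj j i (hj.trans hi.symm)]⟩
      · exact ⟨v, fun i hi' => absurd ⟨i, hi'⟩ hi⟩
    refine ⟨p.elim d Subtype.val, q.elim d Subtype.val, r.elim d Subtype.val, fun w hw => ?_⟩
    by_cases hwP : w ∈ P
    · rcases hc (some ⟨w, hwP⟩) ⟨hw, fun hh => hvQ hh.1⟩ with rfl | rfl | rfl <;> simp
    · obtain ⟨i, hi, rfl⟩ := h.cross v w hvQ hwP hw
      obtain rfl := hd i hi
      rcases hc none ⟨i, hi⟩ with rfl | rfl | rfl <;> simp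
  · rintro ⟨p, q, r, hc⟩
    let g : V → Option P := fun w => if hw : w ∈ P then some ⟨w, hw⟩ else none
    refine ⟨g p, g q, g r, fun w hw => ?_⟩
    obtain - | w := w
    · obtain ⟨i, hi⟩ := hw
      replace hi : a i = v := hi
      have hne : a i ≠ b i := fun e => hvQ (hi ▸ e ▸ h.bQ i)
      have hg : g (b i) = none := dif_neg fun hb => hne (h.bP i hb)
      rcases hc (b i) (hi ▸ h.adj i hne) with e | e | e <;> rw [← e, hg] <;> simp
    · have hg : g w = some w := dif_pos w.2
      rcases hc w hw.1 with e | e | e <;> rw [← e, hg] <;> simp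

theorem Thick.not_cub (hP : Thick G P Q) (hQ : Thick G Q P) (h : Sep G P Q a b) {x : V}
    (hxP : x ∈ P) (hxQ : x ∈ Q) : ¬ Cub G x := by
  rintro ⟨p, q, r, hc⟩
  obtain ⟨c, c', h1, h2, h3, h4, h5⟩ := hP x hxP hxQ
  obtain ⟨d, d', h1', h2', h3', h4', h5'⟩ := hQ x hxQ hxP
  have e1 : c ≠ d := fun e => h2' (e ▸ (h.cover c).resolve_right h2)
  have e2 : c ≠ d' := fun e => h3' (e ▸ (h.cover c).resolve_right h2)
  have e3 : c' ≠ d := fun e => h2' (e ▸ (h.cover c').resolve_right h3)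
  have e4 : c' ≠ d' := fun e => h3' (e ▸ (h.cover c').resolve_right h3)
  have := hc _ h4
  have := hc _ h5
  have := hc _ h4'
  have := hc _ h5'
  grind

theorem Sep.end_of_adj (h : Sep G P Q a b) {p q : V} (hp : p ∈ P) (hq : q ∉ P)
    (hpq : G.Adj p q) : ∃ i, a i = p := by
  by_cases hpQ : p ∈ Q
  · exact h.ends p hp hpQ
  · obtain ⟨i, hi, -⟩ := h.cross p q hpQ hq hpq
    exact ⟨i, hi⟩

theorem Sep.exists_end_ne (h : Sep G P Q a b) (u v : V) : ∃ i, a i ≠ u ∧ a i ≠ v := by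
  by_contra! hc
  have h1 := h.ainj
  have h01 : a 0 ≠ a 1 := fun e => absurd (h1 _ _ e) (by decide)
  have h02 : a 0 ≠ a 2 := fun e => absurd (h1 _ _ e) (by decide)
  have h12 : a 1 ≠ a 2 := fun e => absurd (h1 _ _ e) (by decide)
  have h2 : ∀ i, a i = u ∨ a i = v := fun i => or_iff_not_imp_left.2 (hc i)
  rcases h2 0 with e0 | e0 <;> rcases h2 1 with e1 | e1 <;> rcases h2 2 with e2 | e2 <;>
    first
    | exact h01 (e0.trans e1.symm)
    | exact h02 (e0.trans e2.symm)
    | exact h12 (e1.trans e2.symm)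

/-- The members of `L` that lie in `P`, as vertices of `side G P Q a`. -/
def lift (P L : Set V) : Set (Option P) := {w | ∃ p : P, w = some p ∧ p.1 ∈ L}

theorem some_mem_lift {L : Set V} {p : P} : some p ∈ lift P L ↔ p.1 ∈ L := by
  simp [lift]

theorem none_notMem_lift {L : Set V} : none ∉ lift P L := by
  simp [lift]

theorem Ess.not_cub_of_triangle {H : Set V} {u v z : V} (h : Ess G u v) (h3 : Three G)
    (hcub : ∀ w, w ∉ H → Cub G w) (hM : ∀ w ∈ H, ∀ w' ∈ H, G.Adj w w' → Ess G w w')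
    (huv : G.Adj u v) (huz : G.Adj u z) (hvz : G.Adj v z) (hu : u ∈ H) : ¬ Cub G v := by
  have hz : z ∈ H := by
    by_contra hz
    exact h.not_cub h3 huz.symm hvz.symm (hcub z hz)
  exact (hM u hu z hz huz).not_cub h3 huv.symm hvz

/-- A `2`-separation around an edge inside `P` cannot have both separators outside `P`. -/
theorem EssAt.mem_of_side (h : Sep G P Q a b) (h3K : Three (side G P Q a)) {u v x y : V}
    {L R : Set V} (hu : u ∈ P) (hv : v ∈ P) (he : EssAt G u v L R x y) : x ∈ P ∨ y ∈ P := by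
  by_contra! hxy
  have key : ∀ {u v : V} {L R : Set V}, u ∈ P → v ∈ P → EssAt G u v L R x y →
      ∀ p ∈ L, p ∈ P → p = u := by
    intro u v L R hu hv he p hp hpP
    by_contra hpu
    have := h3K.sep (some ⟨u, hu⟩) none (lift P L) ⟨some ⟨p, hpP⟩, some_mem_lift.2 hp,
      by simpa using hpu, by simp⟩ (by
        rintro (_ | p) hp h1 - q hq
        · exact absurd hp none_notMem_lift
        obtain - | q := q
        · simp
        rw [some_mem_lift] at hp
        rcases he.cover q with h5 | h5 | h5 | h5
        · exact Or.inl (some_mem_lift.2 h5)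
        · exact absurd (congrArg some (Subtype.ext (he.cross _ hp _ h5 hq.1).1)) h1
        · exact absurd (h5 ▸ q.2) hxy.1
        · exact absurd (h5 ▸ q.2) hxy.2) (some ⟨v, hv⟩)
    rcases this with h5 | h5 | h5
    · exact he.disj v (some_mem_lift.1 h5) he.vR
    · exact he.adj.ne (congrArg Subtype.val (Option.some.inj h5)).symm
    · cases h5
  obtain ⟨i, h1, h2⟩ := h.exists_end_ne u v
  rcases he.cover (a i) with h5 | h5 | h5 | h5
  · exact h1 (key hu hv he _ h5 (h.aP i))
  · exact h2 (key hv hu he.symm _ h5 (h.aP i))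
  · exact hxy.1 (h5 ▸ h.aP i)
  · exact hxy.2 (h5 ▸ h.aP i)

theorem EssAt.side_of_mem_of_mem (h : Sep G P Q a b) (h3 : Three G) (hT : Thick G Q P)
    {u v x y : V} {L R : Set V} (hu : u ∈ P) (hv : v ∈ P) (hQ : ¬ (u ∈ Q ∧ v ∈ Q))
    (hx : x ∈ P) (hy : y ∈ P) (he : EssAt G u v L R x y) :
    Ess (side G P Q a) (some ⟨u, hu⟩) (some ⟨v, hv⟩) := by
  have key : ∀ {u v : V} {L R : Set V} (hu : u ∈ P) (hv : v ∈ P), ¬ (u ∈ Q ∧ v ∈ Q) →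
      EssAt G u v L R x y → (∀ w, w ∉ P → w ∉ R) →
      Ess (side G P Q a) (some ⟨u, hu⟩) (some ⟨v, hv⟩) := by
    intro u v L R hu hv hQ he hR
    have hL : ∀ w, w ∉ P → w ∈ L := by
      intro w hw
      rcases he.cover w with h5 | h5 | rfl | rfl
      · exact h5
      · exact absurd h5 (hR w hw)
      · exact absurd hx hw
      · exact absurd hy hw
    have hcr : ∀ c, c ∉ P → ∀ q ∈ R, ¬ G.Adj q c := fun c hc q hq hqc =>
      hc ((he.cross c (hL c hc) q hq hqc.symm).1 ▸ hu)
    have hend : ∀ i, a i ∉ R := by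
      intro i hi
      by_cases hab : a i = b i
      · obtain ⟨c, -, -, hc, -, hac, -⟩ := hT (a i) (hab ▸ h.bQ i) (h.aP i)
        exact hcr c hc _ hi hac
      · exact hcr (b i) (fun hb => hab (h.bP i hb)) _ hi (h.adj i hab)
    refine ⟨insert none (lift P L), lift P R, some ⟨x, hx⟩, some ⟨y, hy⟩, ⟨he.adj, hQ⟩,
      ?_, ?_, ?_, ?_, ?_, ?_, ?_, ?_, ?_, ?_, ?_⟩
    · rintro (_ | w)
      · simp
      · have := he.cover w
        simpa [some_mem_lift, Subtype.ext_iff] using this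
    · rintro (_ | w) hw hw'
      · exact none_notMem_lift hw'
      · exact he.disj w (by simpa [some_mem_lift] using hw) (some_mem_lift.1 hw')
    · simpa [some_mem_lift] using he.xL
    · simpa [some_mem_lift] using he.xR
    · simpa [some_mem_lift] using he.yL
    · simpa [some_mem_lift] using he.yR
    · simpa [some_mem_lift] using he.uL
    · simpa [some_mem_lift] using he.vR
    · rintro (_ | p) hp (_ | q) hq hpq
      · exact hpq.elim
      · obtain ⟨i, hi⟩ := hpq
        exact absurd (hi ▸ some_mem_lift.1 hq) (hend i)
      · exact absurd hq none_notMem_lift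
      · obtain ⟨h1, h2⟩ := he.cross p (by simpa [some_mem_lift] using hp) q (some_mem_lift.1 hq)
          hpq.1
        simp [Subtype.ext_iff, h1, h2]
    · exact ⟨none, by simp, by simp⟩
    · obtain ⟨p, hp, hpv⟩ := he.right
      have hpP : p ∈ P := by_contra fun hc => hR p hc hp
      exact ⟨some ⟨p, hpP⟩, some_mem_lift.2 hp, by simpa using hpv⟩
  have key2 : ∀ {u v : V} {L R : Set V}, u ∈ P → v ∈ P → EssAt G u v L R x y →
      (∃ w, w ∉ P ∧ w ∈ R) → ∀ i, a i ∉ L := by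
    rintro u v L R hu hv he ⟨w, hwP, hwR⟩ i hi
    obtain ⟨j, k, hij, hik, hjk, hl⟩ := fin_three_others i
    have := h3.sep (a j) (a k) {w | w ∉ P ∧ w ∈ R} ⟨w, ⟨hwP, hwR⟩, fun e => hwP (e ▸ h.aP j),
      fun e => hwP (e ▸ h.aP k)⟩ (by
        rintro p ⟨hpP, hpR⟩ - - q hpq
        by_cases hq : q ∈ P
        · obtain ⟨l, rfl⟩ := h.end_of_adj hq hpP hpq.symm
          rcases hl l with rfl | rfl | rfl
          · exact absurd ((he.cross _ hi p hpR hpq.symm).2 ▸ hv) hpP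
          · simp
          · simp
        · rcases he.cover q with h5 | h5 | rfl | rfl
          · exact absurd ((he.cross _ h5 p hpR hpq.symm).2 ▸ hv) hpP
          · exact Or.inl ⟨hq, h5⟩
          · exact absurd hx hq
          · exact absurd hy hq) (a i)
    rcases this with h5 | h5 | h5
    · exact h5.1 (h.aP i)
    · exact hij (h.ainj _ _ h5)
    · exact hik (h.ainj _ _ h5)
  by_cases hR : ∃ w, w ∉ P ∧ w ∈ R
  · by_cases hL : ∃ w, w ∉ P ∧ w ∈ L
    · obtain ⟨i, h1, h2⟩ := h.exists_end_ne x y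
      rcases he.cover (a i) with h5 | h5 | h5 | h5
      · exact absurd h5 (key2 hu hv he hR i)
      · exact absurd h5 (key2 hv hu he.symm hL i)
      · exact absurd h5 h1
      · exact absurd h5 h2
    · push Not at hL
      exact (key hv hu (fun hh => hQ hh.symm) he.symm hL).symm
  · push Not at hR
    exact key hu hv hQ he hR

theorem EssAt.side_of_mem (h : Sep G P Q a b) (h3 : Three G) (h3K : Three (side G P Q a))
    {H : Set V} (hcub : ∀ w, w ∉ H → Cub G w)
    (hM : ∀ w ∈ H, ∀ w' ∈ H, G.Adj w w' → Ess G w w')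
    {u v x y : V} {L R : Set V} (hu : u ∈ P) (hv : v ∈ P) (hQ : ¬ (u ∈ Q ∧ v ∈ Q))
    (hau : ∀ i, a i = u → u ∈ H) (hav : ∀ i, a i = v → v ∈ H)
    (hx : x ∈ P) (hy : y ∉ P) (he : EssAt G u v L R x y) :
    Ess (side G P Q a) (some ⟨u, hu⟩) (some ⟨v, hv⟩) := by
  have nbr : ∀ {u v : V} {L R : Set V}, u ∈ P → EssAt G u v L R x y →
      (∀ p ∈ R, p ∈ P → p = v) → ∀ q, q ∈ P → G.Adj v q → q = u ∨ q = x := by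
    intro u v L R hu he hR q hq hvq
    rcases he.cover q with h5 | h5 | h5 | h5
    · exact Or.inl (he.cross q h5 v he.vR hvq.symm).1
    · exact absurd (hR q h5 hq).symm hvq.ne
    · exact Or.inr h5
    · exact absurd (h5 ▸ hq) hy
  have tri : ∀ {u v : V} {L R : Set V}, u ∈ P → v ∈ P → EssAt G u v L R x y →
      (∀ p ∈ R, p ∈ P → p = v) → G.Adj v x ∧ ∃ i, a i = v := by
    intro u v L R hu hv he hR
    constructor
    · obtain ⟨_ | q, hq, h1, h2⟩ := h3K.exists_adj (some ⟨v, hv⟩) (some ⟨u, hu⟩) none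
      · exact absurd rfl h2
      · rcases nbr hu he hR q q.2 hq.1 with h5 | h5
        · exact absurd (congrArg some (Subtype.ext h5)) h1
        · exact h5 ▸ hq.1
    · obtain ⟨_ | q, hq, h1, h2⟩ := h3K.exists_adj (some ⟨v, hv⟩) (some ⟨u, hu⟩) (some ⟨x, hx⟩)
      · exact hq
      · rcases nbr hu he hR q q.2 hq.1 with h5 | h5
        · exact absurd (congrArg some (Subtype.ext h5)) h1
        · exact absurd (congrArg some (Subtype.ext h5)) h2
  have cub : ∀ {u v : V} {L R : Set V}, u ∈ P → v ∈ P → EssAt G u v L R x y →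
      (∀ p ∈ R, p ∈ P → p = v) → v ∉ Q → Cub G v := by
    intro u v L R hu hv he hR hvQ
    obtain ⟨-, i, rfl⟩ := tri hu hv he hR
    refine ⟨u, x, b i, fun q hq => ?_⟩
    by_cases hqP : q ∈ P
    · have := nbr hu he hR q hqP hq
      tauto
    · obtain ⟨l, h1, h2⟩ := h.cross _ q hvQ hqP hq
      obtain rfl := h.ainj _ _ h1
      exact Or.inr (Or.inr h2.symm)
  have main : ∀ {u v : V} {L R : Set V} (hu : u ∈ P) (hv : v ∈ P), ¬ (u ∈ Q ∧ v ∈ Q) →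
      (∀ i, a i = u → u ∈ H) → (∀ i, a i = v → v ∈ H) → EssAt G u v L R x y →
      (∀ p ∈ R, p ∈ P → p = v) → Ess (side G P Q a) (some ⟨u, hu⟩) (some ⟨v, hv⟩) := by
    intro u v L R hu hv hQ hau hav he hR
    have hess : Ess G u v := ⟨_, _, _, _, he⟩
    obtain ⟨hvx, iv, hiv⟩ := tri hu hv he hR
    by_cases hL : ∀ p ∈ L, p ∈ P → p = u
    · obtain ⟨hux, iu, hiu⟩ := tri hv hu he.symm hL
      by_cases hvQ : v ∈ Q
      · have huQ : u ∉ Q := fun hh => hQ ⟨hh, hvQ⟩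
        exact absurd (cub hv hu he.symm hL huQ)
          (hess.symm.not_cub_of_triangle h3 hcub hM he.adj.symm hvx hux (hav _ hiv))
      · exact absurd (cub hu hv he hR hvQ)
          (hess.not_cub_of_triangle h3 hcub hM he.adj hux hvx (hau _ hiu))
    push Not at hL
    obtain ⟨p₀, hp₀, hp₀P, hp₀u⟩ := hL
    obtain ⟨r, hr, hrv⟩ := he.right
    have hrP : r ∉ P := fun hh => hrv (hR r hr hh)
    have one : ∀ i j, a i ∈ L → a j ∈ L → i = j := by
      intro i j hi hj
      by_contra hij
      obtain ⟨k, hk⟩ := (by decide : ∀ i j : Fin 3, i ≠ j → ∃ k, ∀ l, l = i ∨ l = j ∨ l = k) i j hij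
      have hend : ∀ q, q ∉ L → q ∈ P → ∀ p, p ∉ P → G.Adj p q → q = a k := by
        intro q hqL hqP p hp hpq
        obtain ⟨l, rfl⟩ := h.end_of_adj hqP hp hpq.symm
        rcases hk l with rfl | rfl | rfl
        · exact absurd hi hqL
        · exact absurd hj hqL
        · rfl
      have key := h3.sep y (a k) {w | w ∉ P ∧ w ∈ R} ⟨r, ⟨hrP, hr⟩, fun e => he.yR (e ▸ hr),
        fun e => hrP (e ▸ h.aP k)⟩ (by
          rintro p ⟨hpP, hpR⟩ - - q hpq
          rcases he.cover q with h5 | h5 | h5 | h5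
          · exact absurd ((he.cross _ h5 p hpR hpq.symm).2 ▸ hv) hpP
          · by_cases hqP : q ∈ P
            · exact Or.inr (Or.inr (hend q (fun hh => he.disj q hh h5) hqP p hpP hpq))
            · exact Or.inl ⟨hqP, h5⟩
          · exact Or.inr (Or.inr (hend q (h5 ▸ he.xL) (h5 ▸ hx) p hpP hpq))
          · exact Or.inr (Or.inl h5))
      have key' : ∀ i, a i ∈ L → i = k := by
        intro i hi
        rcases key (a i) with h5 | h5 | h5
        · exact absurd (h.aP i) h5.1
        · exact absurd (h5 ▸ h.aP i) hy
        · exact h.ainj _ _ h5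
      exact hij ((key' i hi).trans (key' j hj).symm)
    obtain ⟨i, hi⟩ : ∃ i, a i ∈ L := by
      obtain ⟨i, h1, h2⟩ := h.exists_end_ne v x
      rcases he.cover (a i) with h5 | h5 | h5 | h5
      · exact ⟨i, h5⟩
      · exact absurd (hR _ h5 (h.aP i)) h1
      · exact absurd h5 h2
      · exact absurd (h5 ▸ h.aP i) hy
    have hui : u ≠ a i := by
      rintro rfl
      have := h3K.sep (some ⟨a i, hu⟩) (some ⟨x, hx⟩) (lift P L) ⟨some ⟨p₀, hp₀P⟩,
        some_mem_lift.2 hp₀, by simpa using hp₀u, by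
          simpa using fun e : p₀ = x => he.xL (e ▸ hp₀)⟩ (by
          rintro (_ | p) hp h1 - (_ | q) hq
          · exact absurd hp none_notMem_lift
          · exact absurd hp none_notMem_lift
          · obtain ⟨l, hl⟩ := hq
            obtain rfl := one l i (hl ▸ some_mem_lift.1 hp) hi
            exact absurd (congrArg some (Subtype.ext hl.symm)) h1
          · rcases he.cover q with h5 | h5 | h5 | h5
            · exact Or.inl (some_mem_lift.2 h5)
            · exact absurd (congrArg some (Subtype.ext
                (he.cross _ (some_mem_lift.1 hp) _ h5 hq.1).1)) h1
            · exact Or.inr (Or.inr (congrArg some (Subtype.ext h5)))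
            · exact absurd (h5 ▸ q.2) hy) (some ⟨v, hv⟩)
      rcases this with h5 | h5 | h5
      · exact he.disj v (some_mem_lift.1 h5) he.vR
      · exact he.adj.ne (congrArg Subtype.val (Option.some.inj h5)).symm
      · exact he.xR ((show v = x from congrArg Subtype.val (Option.some.inj h5)) ▸ he.vR)
    have huend : ∀ l, a l ≠ u := by
      rintro l rfl
      exact hui (congrArg a (one l i he.uL hi))
    by_cases hp : ∃ p ∈ L, p ∈ P ∧ p ≠ u ∧ p ≠ a i
    · obtain ⟨p, hpL, hpP, hpu, hpi⟩ := hp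
      refine ⟨lift P (L \ {a i}), {some ⟨v, hv⟩, none}, some ⟨x, hx⟩, some ⟨a i, h.aP i⟩,
        ⟨he.adj, hQ⟩, ?_, ?_, ?_, ?_, ?_, ?_, ?_, ?_, ?_, ?_, ?_⟩
      · rintro (_ | w)
        · simp
        · have h1 := he.cover w
          have h2 : w.1 ∈ R → w.1 = v := fun hw => hR _ hw w.2
          have h4 : w.1 ≠ y := fun e => hy (e ▸ w.2)
          simp [some_mem_lift, Subtype.ext_iff]
          tauto
      · rintro (_ | w) hw hw'
        · exact none_notMem_lift hw
        · rw [some_mem_lift] at hw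
          simp [Subtype.ext_iff] at hw'
          exact he.disj w hw.1 (hw' ▸ he.vR)
      · exact fun hh => he.xL (some_mem_lift.1 hh).1
      · simpa using fun e : x = v => he.xR (e ▸ he.vR)
      · exact fun hh => (some_mem_lift.1 hh).2 rfl
      · simpa using fun e : a i = v => he.disj _ hi (e ▸ he.vR)
      · exact some_mem_lift.2 ⟨he.uL, hui⟩
      · simp
      · rintro (_ | p) hp (_ | q) hq hpq
        · exact absurd hp none_notMem_lift
        · exact absurd hp none_notMem_lift
        · obtain ⟨l, hl⟩ := hpq
          rw [some_mem_lift] at hp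
          obtain rfl := one l i (hl ▸ hp.1) hi
          exact absurd hl.symm hp.2
        · rw [some_mem_lift] at hp
          simp [Subtype.ext_iff] at hq
          obtain ⟨h1, h2⟩ := he.cross p hp.1 q (hq ▸ he.vR) hpq.1
          simp [Subtype.ext_iff, h1, h2]
      · exact ⟨some ⟨p, hpP⟩, some_mem_lift.2 ⟨hpL, hpi⟩, by simpa using hpu⟩
      · exact ⟨none, by simp, by simp⟩
    push Not at hp
    have hnu : ∀ q ∈ P, G.Adj u q → q = v ∨ q = x ∨ q = a i := by
      intro q hq huq
      rcases he.cover q with h5 | h5 | h5 | h5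
      · exact Or.inr (Or.inr (hp q h5 hq huq.ne'))
      · exact Or.inl (hR q h5 hq)
      · exact Or.inr (Or.inl h5)
      · exact absurd (h5 ▸ hq) hy
    have hux : G.Adj u x := by
      obtain ⟨_ | q, hq, h1, h2⟩ :=
        h3K.exists_adj (some ⟨u, hu⟩) (some ⟨v, hv⟩) (some ⟨a i, h.aP i⟩)
      · obtain ⟨l, hl⟩ := hq
        exact absurd hl (huend l)
      · rcases hnu q q.2 hq.1 with h5 | h5 | h5
        · exact absurd (congrArg some (Subtype.ext h5)) h1
        · exact h5 ▸ hq.1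
        · exact absurd (congrArg some (Subtype.ext h5)) h2
    refine absurd ⟨v, x, a i, fun q hq => ?_⟩
      (hess.symm.not_cub_of_triangle h3 hcub hM he.adj.symm hvx hux (hav _ hiv))
    by_cases hqP : q ∈ P
    · exact hnu q hqP hq
    · obtain ⟨l, hl⟩ := h.end_of_adj hu hqP hq
      exact absurd hl (huend l)
  by_cases hR : ∀ p ∈ R, p ∈ P → p = v
  · exact main hu hv hQ hau hav he hR
  by_cases hL : ∀ p ∈ L, p ∈ P → p = u
  · exact (main hv hu (fun hh => hQ hh.symm) hav hau he.symm hL).symm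
  push Not at hL hR
  obtain ⟨p, hp, hpP, hpu⟩ := hL
  obtain ⟨q, hq, hqP, hqv⟩ := hR
  refine ⟨lift P L, lift P R, some ⟨x, hx⟩, none, ⟨he.adj, hQ⟩,
    ?_, ?_, ?_, ?_, none_notMem_lift, none_notMem_lift, ?_, ?_, ?_, ?_, ?_⟩
  · rintro (_ | w)
    · simp
    · have h1 := he.cover w
      have h4 : w.1 ≠ y := fun e => hy (e ▸ w.2)
      simp [some_mem_lift, Subtype.ext_iff]
      tauto
  · rintro (_ | w) hw hw'
    · exact none_notMem_lift hw'
    · exact he.disj w (some_mem_lift.1 hw) (some_mem_lift.1 hw')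
  · simpa [some_mem_lift] using he.xL
  · simpa [some_mem_lift] using he.xR
  · simpa [some_mem_lift] using he.uL
  · simpa [some_mem_lift] using he.vR
  · rintro (_ | p) hp (_ | q) hq hpq
    · exact hpq.elim
    · exact absurd hp none_notMem_lift
    · exact absurd hq none_notMem_lift
    · obtain ⟨h1, h2⟩ := he.cross p (some_mem_lift.1 hp) q (some_mem_lift.1 hq) hpq.1
      simp [Subtype.ext_iff, h1, h2]
  · exact ⟨some ⟨p, hpP⟩, some_mem_lift.2 hp, by simpa using hpu⟩
  · exact ⟨some ⟨q, hqP⟩, some_mem_lift.2 hq, by simpa using hqv⟩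

theorem Ess.ess_side (h : Sep G P Q a b) (h3 : Three G) (h3K : Three (side G P Q a))
    (hT : Thick G Q P) {H : Set V} (hcub : ∀ w, w ∉ H → Cub G w)
    (hM : ∀ w ∈ H, ∀ w' ∈ H, G.Adj w w' → Ess G w w')
    {u v : V} (hu : u ∈ P) (hv : v ∈ P) (hQ : ¬ (u ∈ Q ∧ v ∈ Q))
    (hau : ∀ i, a i = u → u ∈ H) (hav : ∀ i, a i = v → v ∈ H) (he : Ess G u v) :
    Ess (side G P Q a) (some ⟨u, hu⟩) (some ⟨v, hv⟩) := by
  obtain ⟨L, R, x, y, he⟩ := he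
  by_cases hx : x ∈ P
  · by_cases hy : y ∈ P
    · exact he.side_of_mem_of_mem h h3 hT hu hv hQ hx hy
    · exact he.side_of_mem h h3 h3K hcub hM hu hv hQ hau hav hx hy
  · have hy : y ∈ P := (he.mem_of_side h h3K hu hv).resolve_left hx
    exact he.swap.side_of_mem h h3 h3K hcub hM hu hv hQ hau hav hy hx

/-- A `3`-connected graph with a set `H` of marked vertices such that unmarked vertices are cubic
and edges between marked vertices are essential. -/
structure Marked (G : SimpleGraph V) (H : Set V) : Prop where
  three : Three G
  cub : ∀ v, v ∉ H → Cub G v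
  ess : ∀ u ∈ H, ∀ v ∈ H, G.Adj u v → Ess G u v

open Classical in
/-- Marked vertices have negative weight and unmarked ones have positive weight, with a bonus for
those that are isolated among the unmarked ones and lie on no essential edge. -/
noncomputable def weight (G : SimpleGraph V) (H : Set V) (v : V) : ℤ :=
  if v ∈ H then if Cub G v then -1 else -2
  else if (∀ w, G.Adj v w → w ∈ H) ∧ ∀ w, ¬ Ess G v w then 3 else 2

/-- The lower bound on the total weight of a marked graph. -/
def Heavy [Fintype V] (G : SimpleGraph V) (H : Set V) : Prop :=
  6 ≤ ∑ v, weight G H v ∨ 5 ≤ ∑ v, weight G H v ∧ ∀ v, weight G H v ≤ 2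

variable {H : Set V}

theorem weight_le_three (v : V) : weight G H v ≤ 3 := by
  unfold weight; split_ifs <;> norm_num

theorem weight_le_neg_one {v : V} (hv : v ∈ H) : weight G H v ≤ -1 := by
  unfold weight; split_ifs <;> norm_num

theorem weight_eq_neg_two {v : V} (hv : v ∈ H) (hc : ¬ Cub G v) : weight G H v = -2 := by
  simp [weight, hv, hc]

theorem Ess.adj {u v : V} (h : Ess G u v) : G.Adj u v := by
  obtain ⟨L, R, x, y, h⟩ := h
  exact h.adj

theorem Marked.marked_side [Finite V] (hm : Marked G H) (h : Sep G P Q a b) (hP : Thick G P Q)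
    (hQ : Thick G Q P) : Marked (side G P Q a) (lift P H) := by
  have h3K := h.side_three hm.three hP
  refine ⟨h3K, ?_, ?_⟩
  · rintro (_ | ⟨p, hp⟩) hpH
    · refine ⟨some ⟨a 0, h.aP 0⟩, some ⟨a 1, h.aP 1⟩, some ⟨a 2, h.aP 2⟩, ?_⟩
      rintro (_ | w) hw
      · exact hw.elim
      · obtain ⟨i, hi⟩ := hw
        fin_cases i <;> simp [Subtype.ext_iff, ← hi]
    · have hc := hm.cub p fun hh => hpH (some_mem_lift.2 hh)
      exact (h.cub_side_iff hp fun hpQ => hP.not_cub hQ h hp hpQ hc).2 hc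
  · rintro (_ | ⟨p, hp⟩) hpH (_ | ⟨q, hq⟩) hqH hpq
    · exact hpq.elim
    · exact absurd hpH none_notMem_lift
    · exact absurd hqH none_notMem_lift
    · have hpH := some_mem_lift.1 hpH
      have hqH := some_mem_lift.1 hqH
      exact (hm.ess p hpH q hqH hpq.1).ess_side h hm.three h3K hQ hm.cub hm.ess hp hq hpq.2
        (fun _ _ => hpH) (fun _ _ => hqH)

theorem Marked.weight_side_le [Finite V] (hm : Marked G H) (h : Sep G P Q a b) (hP : Thick G P Q)
    (hQ : Thick G Q P) {p : V} (hp : p ∈ P) (hpQ : p ∉ Q) :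
    weight (side G P Q a) (lift P H) (some ⟨p, hp⟩) ≤ weight G H p := by
  by_cases hpH : p ∈ H
  · have h1 := h.cub_side_iff hp hpQ
    by_cases hc : Cub G p
    · simp [weight, some_mem_lift, hpH, hc, h1.2 hc]
    · simp [weight, some_mem_lift, hpH, hc, mt h1.1 hc]
  have key : ((∀ w, (side G P Q a).Adj (some ⟨p, hp⟩) w → w ∈ lift P H) ∧
      ∀ w, ¬ Ess (side G P Q a) (some ⟨p, hp⟩) w) →
      ((∀ w, G.Adj p w → w ∈ H) ∧ ∀ w, ¬ Ess G p w) := by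
    rintro ⟨h1, h2⟩
    have hend : ∀ i, a i ≠ p := fun i hi => none_notMem_lift (h1 none ⟨i, hi⟩)
    have hnP : ∀ w, G.Adj p w → w ∈ P := fun w hw => by
      by_contra hwP
      obtain ⟨i, hi⟩ := h.end_of_adj hp hwP hw
      exact hend i hi
    have hnH : ∀ w, G.Adj p w → w ∈ H := fun w hw =>
      some_mem_lift.1 (h1 (some ⟨w, hnP w hw⟩) ⟨hw, fun hh => hpQ hh.1⟩)
    refine ⟨hnH, fun w hw => h2 (some ⟨w, hnP w hw.adj⟩) ?_⟩
    exact hw.ess_side h hm.three (hm.marked_side h hP hQ).three hQ hm.cub hm.ess hp _ (fun hh => hpQ hh.1)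
      (fun i hi => absurd hi (hend i)) (fun _ _ => hnH w hw.adj)
  unfold weight
  rw [if_neg (fun hh => hpH (some_mem_lift.1 hh)), if_neg hpH]
  split_ifs with h1 h2
  · exact le_rfl
  · exact absurd (key h1) h2
  · norm_num
  · exact le_rfl

open Classical in
theorem Marked.three_le_sum_side [Fintype V] (hm : Marked G H) (h : Sep G P Q a b)
    (hP : Thick G P Q) (hQ : Thick G Q P)
    (hh : Heavy (side G P Q a) (lift P H)) :
    3 ≤ ∑ v, if v ∈ P then weight G H v + if v ∈ Q then 1 else 0 else 0 := by
  have h1 : ∑ p : P, weight (side G P Q a) (lift P H) (some p) ≤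
      ∑ p : P, (weight G H p + if p.1 ∈ Q then 1 else 0) := by
    refine Finset.sum_le_sum fun p _ => ?_
    split_ifs with hpQ
    · have hc := hP.not_cub hQ h p.2 hpQ
      have hpH : p.1 ∈ H := by_contra fun hh => hc (hm.cub p hh)
      rw [weight_eq_neg_two hpH hc]
      exact weight_le_neg_one (some_mem_lift.2 hpH)
    · simpa using hm.weight_side_le h hP hQ p.2 hpQ
  rw [← Finset.sum_filter, Finset.sum_subtype (p := fun v => v ∈ P) _ (by simp)]
  refine le_trans ?_ h1
  unfold Heavy at hh
  rw [Fintype.sum_option] at hh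
  rcases hh with hh | ⟨hh, h2⟩
  · have := weight_le_three (G := side G P Q a) (H := lift P H) none
    linarith
  · have := h2 none
    linarith

theorem Marked.heavy_of_sep [Fintype V] (hm : Marked G H) (h : Sep G P Q a b)
    (hP : Thick G P Q) (hQ : Thick G Q P)
    (hA : 3 ≤ ∑ v, open Classical in
      if v ∈ P then weight G H v + if v ∈ Q then 1 else 0 else 0)
    (hB : 3 ≤ ∑ v, open Classical in
      if v ∈ Q then weight G H v + if v ∈ P then 1 else 0 else 0) :
    Heavy G H := by
  left
  have key := add_le_add hA hB
  rw [← Finset.sum_add_distrib] at key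
  refine le_trans key (Finset.sum_le_sum fun v _ => ?_)
  have := h.cover v
  by_cases hvP : v ∈ P <;> by_cases hvQ : v ∈ Q
  · have hc := hP.not_cub hQ h hvP hvQ
    have hvH : v ∈ H := by_contra fun hh => hc (hm.cub v hh)
    simp [hvP, hvQ, weight_eq_neg_two hvH hc]
  · simp [hvP, hvQ]
  · simp [hvP, hvQ]
  · tauto

theorem Cub.mem_of_adj {v p q r : V} (h : Cub G v) (hp : G.Adj v p) (hq : G.Adj v q)
    (hr : G.Adj v r) (hpq : p ≠ q) (hpr : p ≠ r) (hqr : q ≠ r) {w : V} (hw : G.Adj v w) :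
    w = p ∨ w = q ∨ w = r := by
  obtain ⟨x, y, z, hc⟩ := h
  have h1 := hc _ hp
  have h2 := hc _ hq
  have h3 := hc _ hr
  have h4 := hc _ hw
  clear hc hp hq hr hw
  grind

theorem Three.exists_three_adj (h : Three G) (v : V) :
    ∃ p q r, G.Adj v p ∧ G.Adj v q ∧ G.Adj v r ∧ p ≠ q ∧ p ≠ r ∧ q ≠ r := by
  obtain ⟨p, hp, -⟩ := h.exists_adj v v v
  obtain ⟨q, hq, hqp, -⟩ := h.exists_adj v p p
  obtain ⟨r, hr, hrp, hrq⟩ := h.exists_adj v p q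
  exact ⟨p, q, r, hp, hq, hr, hqp.symm, hrp.symm, hrq.symm⟩

section Finset

variable [Fintype V]

open Classical in
theorem Three.three_le_card_adj (h : Three G) (v : V) :
    3 ≤ (Finset.univ.filter (G.Adj v)).card := by
  obtain ⟨p, q, r, hp, hq, hr, hpq, hpr, hqr⟩ := h.exists_three_adj v
  have : ({p, q, r} : Finset V) ⊆ Finset.univ.filter (G.Adj v) := by
    intro w hw
    simp only [Finset.mem_insert, Finset.mem_singleton] at hw
    rcases hw with rfl | rfl | rfl <;> simpa
  calc 3 = ({p, q, r} : Finset V).card := (Finset.card_eq_three.2 ⟨p, q, r, hpq, hpr, hqr, rfl⟩).symm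
    _ ≤ _ := Finset.card_le_card this

open Classical in
theorem cub_iff_card_le_three (h : Three G) (v : V) :
    Cub G v ↔ (Finset.univ.filter (G.Adj v)).card ≤ 3 := by
  constructor
  · rintro ⟨p, q, r, hc⟩
    refine (Finset.card_le_card (t := {p, q, r}) fun w hw => ?_).trans Finset.card_le_three
    simpa using hc w (by simpa using hw)
  · intro hle
    obtain ⟨p, q, r, -, -, -, he⟩ := Finset.card_eq_three.1 (le_antisymm hle (h.three_le_card_adj v))
    refine ⟨p, q, r, fun w hw => ?_⟩
    have : w ∈ Finset.univ.filter (G.Adj v) := by simpa using hw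
    simpa [he] using this

end Finset

section Prime

variable [Fintype V]

open Classical in
theorem Three.two_sub_weight_le (h : Three G) {v : V} (hv : v ∈ H) :
    2 - weight G H v ≤ (Finset.univ.filter (G.Adj v)).card := by
  have h1 := h.three_le_card_adj v
  have h2 := cub_iff_card_le_three h v
  unfold weight
  rw [if_pos hv]
  split_ifs with hc
  · omega
  · have := mt h2.2 hc
    omega

open Classical in
theorem Marked.card_marked_adj_le_weight (hm : Marked G H) (hno : ∀ u v, ¬ Ess G u v) {v : V}
    (hv : v ∉ H) : ((Finset.univ.filter (· ∈ H)).filter (G.Adj v)).card ≤ weight G H v := by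
  have h1 := (cub_iff_card_le_three hm.three v).1 (hm.cub v hv)
  have hsub : (Finset.univ.filter (· ∈ H)).filter (G.Adj v) ⊆ Finset.univ.filter (G.Adj v) :=
    Finset.filter_subset_filter _ (Finset.subset_univ _)
  unfold weight
  rw [if_neg hv]
  split_ifs with hc
  · exact_mod_cast (Finset.card_le_card hsub).trans h1
  · have : ∃ w, G.Adj v w ∧ w ∉ H := by
      by_contra! hh
      exact hc ⟨hh, hno v⟩
    obtain ⟨w, hw, hwH⟩ := this
    have hlt := Finset.card_lt_card (Finset.ssubset_iff_subset_ne.2 ⟨hsub, fun e => hwH (by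
      have : w ∈ Finset.univ.filter (G.Adj v) := by simpa using hw
      rw [← e] at this
      simp only [Finset.mem_filter] at this
      exact this.1.2)⟩)
    have : ((Finset.univ.filter (· ∈ H)).filter (G.Adj v)).card ≤ 2 := by omega
    exact_mod_cast this

open Classical in
theorem Marked.adj_subset (hm : Marked G H) (hno : ∀ u v, ¬ Ess G u v) {v : V} (hv : v ∈ H) :
    Finset.univ.filter (G.Adj v) = (Finset.univ.filter (· ∉ H)).filter (G.Adj v) := by
  ext w
  simp only [Finset.mem_filter, Finset.mem_univ, true_and]
  exact ⟨fun hw => ⟨fun hwH => hno v w (hm.ess v hv w hwH hw), hw⟩, fun hw => hw.2⟩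

open Classical in
theorem Marked.two_mul_card_le_sum_weight (hm : Marked G H) (hno : ∀ u v, ¬ Ess G u v) :
    2 * ((Finset.univ.filter (· ∈ H)).card : ℤ) ≤ ∑ v, weight G H v := by
  have h1 := Finset.sum_card_bipartiteAbove_eq_sum_card_bipartiteBelow (s := Finset.univ.filter (· ∈ H))
    (t := Finset.univ.filter (· ∉ H)) G.Adj
  have h2 : ∑ v ∈ Finset.univ.filter (· ∈ H), (2 - weight G H v) ≤
      ∑ v ∈ Finset.univ.filter (· ∈ H),
        (((Finset.univ.filter (· ∉ H)).bipartiteAbove G.Adj v).card : ℤ) := by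
    refine Finset.sum_le_sum fun v hv => ?_
    have hv : v ∈ H := by simpa using hv
    have := hm.three.two_sub_weight_le (H := H) hv
    rwa [hm.adj_subset hno hv] at this
  have h3 : ∑ v ∈ Finset.univ.filter (· ∉ H),
        (((Finset.univ.filter (· ∈ H)).bipartiteBelow G.Adj v).card : ℤ) ≤
      ∑ v ∈ Finset.univ.filter (· ∉ H), weight G H v := by
    refine Finset.sum_le_sum fun v hv => ?_
    have hv : v ∉ H := by simpa using hv
    have := hm.card_marked_adj_le_weight hno hv
    simpa only [Finset.bipartiteBelow, G.adj_comm] using this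
  have h4 := Finset.sum_filter_add_sum_filter_not Finset.univ (· ∈ H) (weight G H)
  rw [Finset.sum_sub_distrib, Finset.sum_const, nsmul_eq_mul] at h2
  have h1' := congrArg (Nat.cast (R := ℤ)) h1
  push_cast at h1'
  linarith

open Classical in
theorem Marked.heavy_of_prime (hm : Marked G H) (hno : ∀ u v, ¬ Ess G u v) : Heavy G H := by
  have hsum := hm.two_mul_card_le_sum_weight hno
  by_cases hH : 3 ≤ (Finset.univ.filter (· ∈ H)).card
  · left; linarith [(by exact_mod_cast hH : (3 : ℤ) ≤ ((Finset.univ.filter (· ∈ H)).card : ℤ))]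
  have hcard : (Finset.univ.filter (· ∈ H)).card + (Finset.univ.filter (· ∉ H)).card =
      Nat.card V := by
    rw [Finset.card_filter_add_card_filter_not, Finset.card_univ, Nat.card_eq_fintype_card]
  have h4 := hm.three.card
  have hT : ∀ v, v ∉ H → weight G H v = 2 := by
    intro v hv
    unfold weight
    rw [if_neg hv, if_neg]
    rintro ⟨h1, -⟩
    refine hH ((hm.three.three_le_card_adj v).trans (Finset.card_le_card fun w hw => ?_))
    simp only [Finset.mem_filter, Finset.mem_univ, true_and] at hw ⊢
    exact h1 w hw
  right
  refine ⟨?_, fun v => ?_⟩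
  swap
  · by_cases hv : v ∈ H
    · linarith [weight_le_neg_one (G := G) hv]
    · rw [hT v hv]
  have hsplit := Finset.sum_filter_add_sum_filter_not Finset.univ (· ∈ H) (weight G H)
  have hsumT : ∑ v ∈ Finset.univ.filter (· ∉ H), weight G H v =
      ∑ v ∈ Finset.univ.filter (· ∉ H), (2 : ℤ) :=
    Finset.sum_congr rfl fun v hv => hT v (by simpa using hv)
  rw [hsumT, Finset.sum_const, nsmul_eq_mul] at hsplit
  have hdeg : ∀ v ∈ H,
      2 - weight G H v ≤ (((Finset.univ.filter (· ∉ H)).filter (G.Adj v)).card : ℤ) := by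
    intro v hv
    rw [← hm.adj_subset hno hv]
    exact hm.three.two_sub_weight_le hv
  have hle : ∀ v, ((Finset.univ.filter (· ∉ H)).filter (G.Adj v)).card ≤
      (Finset.univ.filter (· ∉ H)).card := fun v => Finset.card_le_card (Finset.filter_subset _ _)
  have hcases : (Finset.univ.filter (· ∈ H)).card = 0 ∨ (Finset.univ.filter (· ∈ H)).card = 1 ∨
      (Finset.univ.filter (· ∈ H)).card = 2 := by omega
  rcases hcases with h0 | h1 | h2
  · rw [Finset.card_eq_zero.1 h0, Finset.sum_empty] at hsplit
    omega
  · obtain ⟨p, hp⟩ := Finset.card_eq_one.1 h1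
    have hpH : p ∈ H := by
      have : p ∈ Finset.univ.filter (· ∈ H) := by rw [hp]; simp
      simpa using this
    rw [hp, Finset.sum_singleton] at hsplit
    have := hdeg p hpH
    have := hle p
    omega
  · obtain ⟨p, q, hpq, he⟩ := Finset.card_eq_two.1 h2
    have hmem : ∀ v, v ∈ H ↔ v = p ∨ v = q := by
      intro v
      have : v ∈ Finset.univ.filter (· ∈ H) ↔ v ∈ ({p, q} : Finset V) := by rw [he]
      simpa using this
    have hpH : p ∈ H := (hmem p).2 (Or.inl rfl)
    have hqH : q ∈ H := (hmem q).2 (Or.inr rfl)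
    rw [he, Finset.sum_pair hpq] at hsplit
    have hneg : ∀ v ∈ H, -2 ≤ weight G H v ∧ weight G H v ≤ -1 := by
      intro v hv
      unfold weight
      rw [if_pos hv]
      split_ifs <;> simp
    have := hneg p hpH
    have := hneg q hqH
    have key : ∀ v ∈ H, (∃ w ∉ H, ¬ G.Adj v w) →
        3 - weight G H v ≤ ((Finset.univ.filter (· ∉ H)).card : ℤ) := by
      rintro v hv ⟨w, hw, hvw⟩
      have h5 := hdeg v hv
      have h6 : ((Finset.univ.filter (· ∉ H)).filter (G.Adj v)).card <
          (Finset.univ.filter (· ∉ H)).card :=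
        Finset.card_lt_card (Finset.filter_ssubset.2 ⟨w, by simpa using hw, hvw⟩)
      omega
    by_cases hp : ∃ w ∉ H, ¬ G.Adj p w
    · have := key p hpH hp
      omega
    by_cases hq : ∃ w ∉ H, ¬ G.Adj q w
    · have := key q hqH hq
      omega
    push Not at hp hq
    exfalso
    have h5 := hdeg p hpH
    have h6 := hle p
    obtain ⟨r, hr⟩ : (Finset.univ.filter (· ∉ H)).Nonempty := Finset.card_pos.1 (by omega)
    have hr : r ∉ H := by simpa using hr
    obtain ⟨s, hrs, hsp, hsq⟩ := hm.three.exists_adj r p q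
    have hs : s ∉ H := fun hh => by have := (hmem s).1 hh; tauto
    have nbr : ∀ r s, r ∉ H → s ∉ H → G.Adj r s → ∀ w, G.Adj r w → w = p ∨ w = q ∨ w = s := by
      intro r s hr hs hrs w hw
      exact (hm.cub r hr).mem_of_adj (hp r hr).symm (hq r hr).symm hrs hpq
        (fun e => hs (e ▸ hpH)) (fun e => hs (e ▸ hqH)) hw
    have := hm.three.sep p q {r, s} ⟨r, by simp, fun e => hr (e ▸ hpH), fun e => hr (e ▸ hqH)⟩ (by
      rintro v hv - - w hw
      simp only [Set.mem_insert_iff, Set.mem_singleton_iff] at hv ⊢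
      rcases hv with rfl | rfl
      · have := nbr _ _ hr hs hrs w hw; tauto
      · have := nbr _ _ hs hr hrs.symm w hw; tauto)
    have hsub : Finset.univ.filter (· ∉ H) ⊆ {r, s} := by
      intro w hw
      have hw : w ∉ H := by simpa using hw
      have h7 := this w
      have h8 := hmem w
      simp only [Set.mem_insert_iff, Set.mem_singleton_iff] at h7
      simp only [Finset.mem_insert, Finset.mem_singleton]
      tauto
    have h9 := (Finset.card_le_card hsub).trans Finset.card_le_two
    omega

end Prime

theorem Marked.heavy [Fintype V] (hm : Marked G H) : Heavy G H := by
  classical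
  induction hn : Nat.card V using Nat.strong_induction_on generalizing V with
  | _ n ih =>
    by_cases hno : ∀ u v, ¬ Ess G u v
    · exact hm.heavy_of_prime hno
    push Not at hno
    obtain ⟨u, v, L, R, x, y, he⟩ := hno
    obtain ⟨P, Q, a, b, h, hP, hQ⟩ := (he.sep hm.three).exists_thick hm.three
    refine hm.heavy_of_sep h hP hQ ?_ ?_
    · exact hm.three_le_sum_side h hP hQ
        (ih _ (hn ▸ h.card_side_lt) (hm.marked_side h hP hQ) rfl)
    · exact hm.three_le_sum_side h.symm hQ hP
        (ih _ (hn ▸ h.symm.card_side_lt) (hm.marked_side h.symm hQ hP) rfl)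

theorem mem_of_reachable {A : Set V} (hA : ∀ p ∈ A, ∀ q, G.Adj p q → q ∈ A) {p q : V}
    (hp : p ∈ A) (h : G.Reachable p q) : q ∈ A := by
  obtain ⟨w⟩ := h
  induction w with
  | nil => exact hp
  | cons hadj _ ih => exact ih (hA _ hp _ hadj)

/-- The set `S` separates `L` from `R` in `G`. -/
structure IsCut (G : SimpleGraph V) (S L R : Set V) : Prop where
  left : L.Nonempty
  right : R.Nonempty
  cover : ∀ w, w ∈ L ∨ w ∈ R ∨ w ∈ S
  disj : ∀ w ∈ L, w ∉ R
  leftS : ∀ w ∈ L, w ∉ S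
  rightS : ∀ w ∈ R, w ∉ S
  notAdj : ∀ p ∈ L, ∀ q ∈ R, ¬ G.Adj p q

theorem IsCut.symm {S L R : Set V} (h : IsCut G S L R) : IsCut G S R L :=
  ⟨h.right, h.left, fun w => by have := h.cover w; tauto, fun w hw hw' => h.disj w hw' hw,
    h.rightS, h.leftS, fun p hp q hq hpq => h.notAdj q hq p hp hpq.symm⟩

theorem exists_isCut [Finite V] (h3 : 3 < Nat.card V) (h : ¬ KConnected 3 G) :
    ∃ S L R, S.ncard < 3 ∧ IsCut G S L R := by
  unfold KConnected at h
  push Not at h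
  obtain ⟨S, hS, hn⟩ := h h3
  have hne : Nonempty (Sᶜ : Set V) := by
    have h1 := Set.ncard_add_ncard_compl S
    exact ((Set.ncard_pos (Set.toFinite _)).1 (by omega : 0 < Sᶜ.ncard)).to_subtype
  have hpre : ¬ (G.induce Sᶜ).Preconnected := fun hp => hn ⟨hp⟩
  unfold Preconnected at hpre
  push Not at hpre
  obtain ⟨p, q, hpq⟩ := hpre
  refine ⟨S, {w | ∃ hw : w ∈ Sᶜ, (G.induce Sᶜ).Reachable p ⟨w, hw⟩},
    {w | ∃ hw : w ∈ Sᶜ, ¬ (G.induce Sᶜ).Reachable p ⟨w, hw⟩}, hS, ?_⟩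
  refine ⟨⟨p, p.2, Reachable.refl _⟩, ⟨q, q.2, hpq⟩, ?_, ?_, ?_, ?_, ?_⟩
  · intro w
    by_cases hw : w ∈ S
    · exact Or.inr (Or.inr hw)
    · by_cases hr : (G.induce Sᶜ).Reachable p ⟨w, hw⟩
      · exact Or.inl ⟨hw, hr⟩
      · exact Or.inr (Or.inl ⟨hw, hr⟩)
  · rintro w ⟨_, h1⟩ ⟨_, h2⟩
    exact h2 h1
  · exact fun w hw => hw.1
  · exact fun w hw => hw.1
  · rintro v ⟨hv, h1⟩ w ⟨hw, h2⟩ hvw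
    have hadj : (G.induce Sᶜ).Adj ⟨v, hv⟩ ⟨w, hw⟩ := hvw
    exact h2 (h1.trans hadj.reachable)

theorem not_isCut (h : KConnected 3 G) {S L R : Set V} (hS : S.ncard < 3) :
    ¬ IsCut G S L R := by
  intro hc
  obtain ⟨p, hp⟩ := hc.left
  obtain ⟨q, hq⟩ := hc.right
  have hr := (h.2 S hS).preconnected ⟨p, hc.leftS p hp⟩ ⟨q, hc.rightS q hq⟩
  have hm : (⟨q, hc.rightS q hq⟩ : (Sᶜ : Set V)) ∈ (Subtype.val ⁻¹' L : Set (Sᶜ : Set V)) := by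
    refine mem_of_reachable ?_ ?_ hr
    · intro v hv w hvw
      rcases hc.cover w with h1 | h1 | h1
      · exact h1
      · exact absurd hvw (hc.notAdj v hv w h1)
      · exact absurd h1 w.2
    · exact hp
  exact hc.disj q hm hq

theorem three_of_kConnected [Finite V] (h : KConnected 3 G) : Three G := by
  refine Three.of_parts h.1 fun s t L R hL hR hcov hdis hLst hRst hno => ?_
  refine not_isCut h (S := {s, t}) ?_ ⟨hL, hR, ?_, hdis, ?_, ?_, hno⟩
  · have := Set.ncard_insert_le s {t}
    rw [Set.ncard_singleton] at this
    omega
  · intro w; simpa using hcov w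
  · intro w hw; simpa using hLst w hw
  · intro w hw; simpa using hRst w hw

theorem exists_adj_notMem [Finite V] {u : V} (hu : ¬ Cub G u) {S : Set V} (hS : S.ncard < 3) (v : V) :
    ∃ p, G.Adj u p ∧ p ∉ S ∧ p ≠ v := by
  obtain ⟨x, y, hxy⟩ : ∃ x y, S ⊆ {x, y} := by
    have : S.ncard = 0 ∨ S.ncard = 1 ∨ S.ncard = 2 := by omega
    rcases this with h | h | h
    · rw [(Set.ncard_eq_zero (Set.toFinite _)).1 h]
      exact ⟨u, u, by simp⟩
    · obtain ⟨x, rfl⟩ := Set.ncard_eq_one.1 h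
      exact ⟨x, x, by simp⟩
    · obtain ⟨x, y, -, rfl⟩ := Set.ncard_eq_two.1 h
      exact ⟨x, y, le_rfl⟩
  by_contra! hc
  refine hu ⟨x, y, v, fun w hw => ?_⟩
  by_cases hwS : w ∈ S
  · have := hxy hwS
    simp only [Set.mem_insert_iff, Set.mem_singleton_iff] at this
    tauto
  · exact Or.inr (Or.inr (hc w hw hwS))

theorem ess_of_cross [Finite V] (h3 : Three G) {S L R : Set V} (hS : S.ncard < 3)
    (hcov : ∀ w, w ∈ L ∨ w ∈ R ∨ w ∈ S) (hdis : ∀ w ∈ L, w ∉ R) (hL : ∀ w ∈ L, w ∉ S)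
    (hR : ∀ w ∈ R, w ∉ S) {u v : V} (huv : G.Adj u v) (hu : u ∈ L) (hv : v ∈ R)
    (hcross : ∀ p ∈ L, ∀ q ∈ R, G.Adj p q → p = u ∧ q = v) (hleft : ∃ p ∈ L, p ≠ u)
    (hright : ∃ p ∈ R, p ≠ v) : Ess G u v := by
  have key : ∀ s, s ∉ L → s ≠ v → ¬ ∀ w ∈ S, w = s ∨ w = u := by
    intro s hsL hsv hs
    obtain ⟨p, hp, hpu⟩ := hleft
    have := h3.sep u s L ⟨p, hp, hpu, fun e => hsL (e ▸ hp)⟩ (by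
      intro p hp hpu hps q hpq
      rcases hcov q with h1 | h1 | h1
      · exact Or.inl h1
      · exact absurd (hcross p hp q h1 hpq).1 hpu
      · have := hs q h1
        tauto) v
    rcases this with h1 | h1 | h1
    · exact hdis v h1 hv
    · exact huv.ne h1.symm
    · exact hsv h1.symm
  have : S.ncard = 0 ∨ S.ncard = 1 ∨ S.ncard = 2 := by omega
  rcases this with h | h | h
  · have hS := (Set.ncard_eq_zero (Set.toFinite _)).1 h
    obtain ⟨p, hp, hpv⟩ := hright
    exact absurd (by simp [hS]) (key p (fun hh => hdis p hh hp) hpv)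
  · obtain ⟨x, rfl⟩ := Set.ncard_eq_one.1 h
    exact absurd (by simp) (key x (fun hh => hL x hh rfl) (fun e => hR v hv e.symm))
  · obtain ⟨x, y, -, rfl⟩ := Set.ncard_eq_two.1 h
    refine ⟨L, R, x, y, huv, fun w => by simpa using hcov w, hdis, ?_, ?_, ?_, ?_, hu, hv, hcross,
      hleft, hright⟩
    · exact fun hh => hL x hh (by simp)
    · exact fun hh => hR x hh (by simp)
    · exact fun hh => hL y hh (by simp)
    · exact fun hh => hR y hh (by simp)

theorem ess_of_not_kConnected_deleteEdges [Finite V] (h : KConnected 3 G) {u v : V}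
    (huv : G.Adj u v) (hd : ¬ KConnected 3 (G.deleteEdges {s(u, v)})) (hu : ¬ Cub G u)
    (hv : ¬ Cub G v) : Ess G u v := by
  obtain ⟨S, L, R, hS, hc⟩ := exists_isCut h.1 hd
  have main : ∀ L R, IsCut (G.deleteEdges {s(u, v)}) S L R → u ∈ L → v ∈ R → Ess G u v := by
    intro L R hc huL hvR
    have hcross : ∀ p ∈ L, ∀ q ∈ R, G.Adj p q → p = u ∧ q = v := by
      intro p hp q hq hpq
      have h1 := hc.notAdj p hp q hq
      simp only [deleteEdges_adj, Set.mem_singleton_iff, not_and, not_not] at h1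
      rcases Sym2.eq_iff.1 (h1 hpq) with h2 | h2
      · exact h2
      · exact absurd huL fun hh => hc.disj u hh (h2.2 ▸ hq)
    refine ess_of_cross (three_of_kConnected h) hS hc.cover hc.disj hc.leftS hc.rightS huv huL hvR
      hcross ?_ ?_
    · obtain ⟨p, hp, hpS, hpv⟩ := exists_adj_notMem hu hS v
      rcases hc.cover p with h1 | h1 | h1
      · exact ⟨p, h1, hp.ne'⟩
      · exact absurd (hcross u huL p h1 hp).2 hpv
      · exact absurd h1 hpS
    · obtain ⟨p, hp, hpS, hpu⟩ := exists_adj_notMem hv hS u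
      rcases hc.cover p with h1 | h1 | h1
      · exact absurd (hcross p h1 v hvR hp.symm).1 hpu
      · exact ⟨p, h1, hp.ne'⟩
      · exact absurd h1 hpS
  have hex : ∃ p ∈ L, ∃ q ∈ R, G.Adj p q := by
    by_contra! hno
    exact not_isCut h hS ⟨hc.left, hc.right, hc.cover, hc.disj, hc.leftS, hc.rightS, hno⟩
  obtain ⟨p, hp, q, hq, hpq⟩ := hex
  have h1 := hc.notAdj p hp q hq
  simp only [deleteEdges_adj, Set.mem_singleton_iff, not_and, not_not] at h1
  rcases Sym2.eq_iff.1 (h1 hpq) with ⟨rfl, rfl⟩ | ⟨rfl, rfl⟩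
  · exact main L R hc hp hq
  · exact main R L hc.symm hq hp

theorem exists_ess_of_not_kConnected_induce [Finite V] (h : KConnected 3 G) {v : V}
    (hd : ¬ KConnected 3 (G.induce {v}ᶜ)) (hv : Cub G v) (hn : ∀ w, G.Adj v w → ¬ Cub G w) :
    ∃ w, Ess G v w := by
  classical
  have h3 := three_of_kConnected h
  have hcard : 3 < Nat.card ({v}ᶜ : Set V) := by
    have := Fintype.ofFinite V
    obtain ⟨u, hu, -⟩ := h3.exists_adj v v v
    have h1 := mt (cub_iff_card_le_three h3 u).2 (hn u hu)
    have h2 : (Finset.univ.filter (G.Adj u)).card < Nat.card V := by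
      rw [Nat.card_eq_fintype_card, ← Finset.card_univ]
      exact Finset.card_lt_card (Finset.filter_ssubset.2 ⟨u, by simp, by simp⟩)
    have h4 := Set.ncard_add_ncard_compl {v}
    rw [Set.ncard_singleton] at h4
    change 3 < Set.ncard {v}ᶜ
    omega
  obtain ⟨S', L', R', hS', hc⟩ := exists_isCut hcard hd
  obtain ⟨S, L, R, hS, hL, hR, hvL, hvR, hvS, hcov, hdis, hLS, hRS, hno⟩ : ∃ S L R : Set V,
      S.ncard < 3 ∧ L.Nonempty ∧ R.Nonempty ∧ v ∉ L ∧ v ∉ R ∧ v ∉ S ∧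
      (∀ w, w ≠ v → w ∈ L ∨ w ∈ R ∨ w ∈ S) ∧ (∀ w ∈ L, w ∉ R) ∧ (∀ w ∈ L, w ∉ S) ∧
      (∀ w ∈ R, w ∉ S) ∧ ∀ p ∈ L, ∀ q ∈ R, ¬ G.Adj p q := by
    refine ⟨Set.image Subtype.val S', Set.image Subtype.val L', Set.image Subtype.val R', ?_, hc.left.image _,
      hc.right.image _, by simp, by simp, by simp, ?_, ?_, ?_, ?_, ?_⟩
    · rwa [Set.ncard_image_of_injective _ Subtype.val_injective]
    · intro w hw
      rcases hc.cover ⟨w, hw⟩ with h1 | h1 | h1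
      · exact Or.inl ⟨_, h1, rfl⟩
      · exact Or.inr (Or.inl ⟨_, h1, rfl⟩)
      · exact Or.inr (Or.inr ⟨_, h1, rfl⟩)
    · rintro _ ⟨w, hw, rfl⟩ ⟨w', hw', e⟩
      exact hc.disj w hw (Subtype.ext e ▸ hw')
    · rintro _ ⟨w, hw, rfl⟩ ⟨w', hw', e⟩
      exact hc.leftS w hw (Subtype.ext e ▸ hw')
    · rintro _ ⟨w, hw, rfl⟩ ⟨w', hw', e⟩
      exact hc.rightS w hw (Subtype.ext e ▸ hw')
    · rintro _ ⟨p, hp, rfl⟩ _ ⟨q, hq, rfl⟩ hpq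
      exact hc.notAdj p hp q hq hpq
  have hex : ∀ L R : Set V, L.Nonempty → v ∉ L → v ∉ S → (∀ w, w ≠ v → w ∈ L ∨ w ∈ R ∨ w ∈ S) →
      (∀ w ∈ L, w ∉ R) → (∀ w ∈ L, w ∉ S) → (∀ w ∈ R, w ∉ S) →
      (∀ p ∈ L, ∀ q ∈ R, ¬ G.Adj p q) → ∃ p ∈ L, G.Adj v p := by
    intro L R hL hvL hvS hcov hdis hLS hRS hno
    by_contra! hh
    refine not_isCut h hS (L := L) (R := insert v R) ⟨hL, ⟨v, by simp⟩, ?_, ?_, hLS, ?_, ?_⟩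
    · intro w
      have := hcov w
      simp only [Set.mem_insert_iff]
      tauto
    · rintro w hw (rfl | hw')
      · exact hvL hw
      · exact hdis w hw hw'
    · rintro w (rfl | hw)
      · exact hvS
      · exact hRS w hw
    · rintro p hp q (rfl | hq) hpq
      · exact hh p hp hpq.symm
      · exact hno p hp q hq hpq
  have main : ∀ (L R : Set V) (p : V), R.Nonempty → v ∉ L → v ∉ R → v ∉ S →
      (∀ w, w ≠ v → w ∈ L ∨ w ∈ R ∨ w ∈ S) →
      (∀ w ∈ L, w ∉ R) → (∀ w ∈ L, w ∉ S) → (∀ w ∈ R, w ∉ S) →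
      (∀ p ∈ L, ∀ q ∈ R, ¬ G.Adj p q) → p ∈ L → G.Adj v p → (∀ q ∈ L, G.Adj v q → q = p) →
      Ess G v p := by
    intro L R p ⟨r, hr⟩ hvL hvR hvS hcov hdis hLS hRS hno hp hvp huniq
    refine (ess_of_cross h3 (L := L) (R := insert v R) hS ?_ ?_ hLS ?_ hvp.symm hp (by simp)
      ?_ ?_ ⟨r, by simp [hr], fun e => hvR (e ▸ hr)⟩).symm
    · intro w
      have := hcov w
      simp only [Set.mem_insert_iff]
      tauto
    · rintro w hw (rfl | hw')
      · exact hvL hw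
      · exact hdis w hw hw'
    · rintro w (rfl | hw)
      · exact hvS
      · exact hRS w hw
    · rintro w hw q (rfl | hq) hpq
      · exact ⟨huniq w hw hpq.symm, rfl⟩
      · exact absurd hpq (hno w hw q hq)
    · obtain ⟨q, hq, hqS, hqv⟩ := exists_adj_notMem (hn p hvp) hS v
      rcases hcov q hqv with h1 | h1 | h1
      · exact ⟨q, h1, hq.ne'⟩
      · exact absurd hq (hno p hp q h1)
      · exact absurd h1 hqS
  have hcov' : ∀ w, w ≠ v → w ∈ R ∨ w ∈ L ∨ w ∈ S := fun w hw => by have := hcov w hw; tauto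
  have hdis' : ∀ w ∈ R, w ∉ L := fun w hw hw' => hdis w hw' hw
  have hno' : ∀ p ∈ R, ∀ q ∈ L, ¬ G.Adj p q := fun p hp q hq hpq => hno q hq p hp hpq.symm
  obtain ⟨p, hp, hvp⟩ := hex L R hL hvL hvS hcov hdis hLS hRS hno
  obtain ⟨q, hq, hvq⟩ := hex R L hR hvR hvS hcov' hdis' hRS hLS hno'
  by_cases hp1 : ∀ q ∈ L, G.Adj v q → q = p
  · exact ⟨p, main L R p hR hvL hvR hvS hcov hdis hLS hRS hno hp hvp hp1⟩
  by_cases hq1 : ∀ p ∈ R, G.Adj v p → p = q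
  · exact ⟨q, main R L q hL hvR hvL hvS hcov' hdis' hRS hLS hno' hq hvq hq1⟩
  push Not at hp1 hq1
  obtain ⟨p', hp', hvp', hpp⟩ := hp1
  obtain ⟨q', hq', hvq', hqq⟩ := hq1
  rcases hv.mem_of_adj hvp hvp' hvq hpp.symm (fun e => hdis p hp (e ▸ hq))
    (fun e => hdis p' hp' (e ▸ hq)) hvq' with rfl | rfl | rfl
  · exact absurd hq' (hdis _ hp)
  · exact absurd hq' (hdis _ hp')
  · exact absurd rfl hqq

end ThreeConnectedCount

/-- A graph that is both minimally 3-connected and critically 3-connected has at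
least `(|V(G)| + 3)/2` vertices of degree three, i.e. `2·|{v : deg v = 3}| ≥ |V(G)| + 3`. -/
theorem minimally_critically_three_connected_degree_three_count {V : Type*} [Fintype V]
    (G : SimpleGraph V) (hmin : MinimallyKConnected 3 G)
    (hcrit : CriticallyKConnected 3 G) :
    Nat.card V + 3 ≤ 2 * {v : V | (G.neighborSet v).ncard = 3}.ncard := by
  classical
  open ThreeConnectedCount in
  have h3 := three_of_kConnected hmin.1
  have hm : Marked G {v | ¬ Cub G v} := by
    refine ⟨h3, fun v hv => not_not.1 hv, fun u hu v hv huv => ?_⟩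
    exact ess_of_not_kConnected_deleteEdges hmin.1 huv (hmin.2 s(u, v) huv) hu hv
  have hw : ∀ v, weight G {v | ¬ Cub G v} v = if Cub G v then 2 else -2 := by
    intro v
    by_cases hv : Cub G v
    · have : ¬ ((∀ w, G.Adj v w → w ∈ {v | ¬ Cub G v}) ∧ ∀ w, ¬ Ess G v w) := by
        rintro ⟨h1, h2⟩
        obtain ⟨w, hw⟩ := exists_ess_of_not_kConnected_induce hmin.1 (hcrit.2 v) hv h1
        exact h2 w hw
      have hv' : v ∉ {v | ¬ Cub G v} := not_not.2 hv
      rw [weight, if_neg hv', if_neg this, if_pos hv]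
    · rw [weight_eq_neg_two hv hv, if_neg hv]
  have hset : {v : V | (G.neighborSet v).ncard = 3} = (Finset.univ.filter (Cub G ·) : Finset V) := by
    ext v
    have h1 := h3.three_le_card_adj v
    have h2 : (G.neighborSet v).ncard = (Finset.univ.filter (G.Adj v)).card := by
      rw [← Set.ncard_coe_finset]
      congr 1
      ext w
      simp
    simp only [Set.mem_ofPred_eq, Finset.coe_filter, Finset.mem_univ, true_and, h2,
      cub_iff_card_le_three h3]
    omega
  have hsum : 5 ≤ ∑ v, weight G {v | ¬ Cub G v} v := by
    rcases hm.heavy with h | h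
    · linarith
    · exact h.1
  rw [Finset.sum_congr rfl fun v _ => hw v, Finset.sum_ite, Finset.sum_const, Finset.sum_const,
    nsmul_eq_mul, nsmul_eq_mul] at hsum
  have hcard := Finset.card_filter_add_card_filter_not (s := Finset.univ) (Cub G ·)
  rw [Finset.card_univ, ← Nat.card_eq_fintype_card] at hcard
  rw [hset, Set.ncard_coe_finset]
  omega
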